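/- arXiv:1310.2872 — 3 statements merged into one kernel-verified Lean document; each statement's English description precedes it below -/
import Mathlib

section
/- Let G be a finite simple graph on vertex set {x_{11}, …, x_{n1}}, let m_1, …, m_n ≥ 3 be integers, and for each i let C_{m_i} be a cycle graph of length m_i containing the vertex x_{i1}. Then the attachment graph G(C_{m_1}, …, C_{m_n}) is vertex decomposable if and only if m_i ∈ {3, 5} for all i = 1, …, n. -/
variable {V : Type*} [DecidableEq V]

/-- `S` is an independent set of the induced subgraph of `G` on the vertex set `A`. -/
def IsIndepIn (G : SimpleGraph V) (A S : Finset V) : Prop :=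
  S ⊆ A ∧ ∀ u ∈ S, ∀ v ∈ S, ¬G.Adj u v

/-- `S` is a maximal independent set of the induced subgraph of `G` on the vertex set `A`. -/
def IsMaxIndepIn (G : SimpleGraph V) (A S : Finset V) : Prop :=
  IsIndepIn G A S ∧ ∀ T, IsIndepIn G A T → S ⊆ T → S = T

/-- The induced subgraph of `G` on `A` is unmixed: all maximal independent sets
have the same cardinality. -/
def UnmixedOn (G : SimpleGraph V) (A : Finset V) : Prop :=
  ∀ S T, IsMaxIndepIn G A S → IsMaxIndepIn G A T → S.card = T.card

open scoped Classical in
/-- The vertex set `A \ N_G[x]`. -/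
noncomputable def delClosedNbhd (G : SimpleGraph V) (A : Finset V) (x : V) : Finset V :=
  A.filter fun y => y ≠ x ∧ ¬G.Adj x y

/-- The induced subgraph of `G` on `A` is vertex decomposable. -/
inductive VertexDecomposableOn (G : SimpleGraph V) : Finset V → Prop
  | edgeless (A : Finset V) (h : ∀ u ∈ A, ∀ v ∈ A, ¬G.Adj u v) : VertexDecomposableOn G A
  | shed (A : Finset V) (x : V) (hx : x ∈ A)
      (hlink : VertexDecomposableOn G (delClosedNbhd G A x))
      (hdel : VertexDecomposableOn G (A.erase x))
      (hexch : ∀ S, IsIndepIn G (delClosedNbhd G A x) S →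
        ∃ y ∈ A, G.Adj x y ∧ IsIndepIn G (A.erase x) (insert y S)) :
      VertexDecomposableOn G A

/-- `x` is a shedding vertex of the induced subgraph of `G` on `A`. -/
def IsSheddingVertexOn (G : SimpleGraph V) (A : Finset V) (x : V) : Prop :=
  x ∈ A ∧
  VertexDecomposableOn G (delClosedNbhd G A x) ∧
  VertexDecomposableOn G (A.erase x) ∧
  ∀ S, IsIndepIn G (delClosedNbhd G A x) S →
    ∃ y ∈ A, G.Adj x y ∧ IsIndepIn G (A.erase x) (insert y S)

/-- The independence complex of the induced subgraph of `G` on `A` is shellable: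
there is an ordering `F 0, F 1, …` of its facets (the maximal independent sets) such
that for every `i`, every face of the subcomplex `(⋃ j < i, ⟨F j⟩) ∩ ⟨F i⟩` is contained
in a face of that subcomplex of cardinality `(F i).card - 1` (i.e. the subcomplex is
pure of dimension `dim (F i) - 1`). -/
def ShellableOn (G : SimpleGraph V) (A : Finset V) : Prop :=
  ∃ (t : ℕ) (F : Fin t → Finset V),
    Function.Injective F ∧
    (∀ S, IsMaxIndepIn G A S ↔ ∃ i, F i = S) ∧
    ∀ i : Fin t, ∀ S : Finset V, S ⊆ F i → (∃ j, j < i ∧ S ⊆ F j) →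
      ∃ S' : Finset V, S ⊆ S' ∧ S' ⊆ F i ∧ (∃ j, j < i ∧ S' ⊆ F j) ∧
        S'.card = (F i).card - 1

/-- A graph is chordal if every cycle of length at least four has a chord, i.e. an
edge of the graph joining two vertices of the cycle that is not an edge of the cycle. -/
def IsChordal (G : SimpleGraph V) : Prop :=
  ∀ (x : V) (w : G.Walk x x), w.IsCycle → 4 ≤ w.length →
    ∃ u v, u ∈ w.support ∧ v ∈ w.support ∧ G.Adj u v ∧ s(u, v) ∉ w.edges

/-- The induced subgraph of `G` on `A` is a cycle graph on `m` vertices. -/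
def IsCycleGraphOn (G : SimpleGraph V) (A : Finset V) (m : ℕ) : Prop :=
  (∀ u v, G.Adj u v → u ∈ A ∧ v ∈ A) ∧
  Nonempty (G.induce (A : Set V) ≃g SimpleGraph.cycleGraph m)

/-- The independence number of the induced subgraph of `G` on `A`. -/
noncomputable def indepNumOn (G : SimpleGraph V) (A : Finset V) : ℕ :=
  sSup {k | ∃ S, IsIndepIn G A S ∧ S.card = k}

theorem vd_link_aux {V : Type*} [DecidableEq V] (H : SimpleGraph V) (A : Finset V)
    (h : VertexDecomposableOn H A) :
    ∀ (F R : Finset V), IsIndepIn H A F →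
      (∀ z, z ∈ R ↔ z ∈ A ∧ z ∉ F ∧ ∀ s ∈ F, ¬ H.Adj s z) → VertexDecomposableOn H R := by
  induction h with
  | edgeless A h =>
    intro F R hF hR
    exact .edgeless _ fun u hu v hv => h u ((hR u).1 hu).1 v ((hR v).1 hv).1
  | shed A x hx hlink hdel hexch ih1 ih2 =>
    intro F R hF hR
    by_cases hxF : x ∈ F
    · refine ih1 (F.erase x) R ⟨?_, ?_⟩ ?_
      · intro u hu
        have hu' := Finset.mem_erase.1 hu
        simp only [delClosedNbhd, Finset.mem_filter]
        exact ⟨hF.1 hu'.2, hu'.1, hF.2 _ hxF _ hu'.2⟩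
      · intro u hu v hv
        exact hF.2 u (Finset.mem_of_mem_erase hu) v (Finset.mem_of_mem_erase hv)
      · intro z
        rw [hR]
        simp only [delClosedNbhd, Finset.mem_filter, Finset.mem_erase]
        constructor
        · rintro ⟨h1, h2, h3⟩
          exact ⟨⟨h1, fun e => h2 (e ▸ hxF), h3 x hxF⟩, fun e => h2 e.2, fun s hs => h3 s hs.2⟩
        · rintro ⟨⟨h1, h2, h3⟩, h4, h5⟩
          refine ⟨h1, fun e => h4 ⟨h2, e⟩, fun s hs => ?_⟩
          by_cases e : s = x
          · rw [e]; exact h3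
          · exact h5 s ⟨e, hs⟩
    · by_cases hadj : ∃ s ∈ F, H.Adj s x
      · obtain ⟨s, hs, hsx⟩ := hadj
        refine ih2 F R ⟨?_, hF.2⟩ ?_
        · intro u hu
          exact Finset.mem_erase.2 ⟨fun e => hxF (e ▸ hu), hF.1 hu⟩
        · intro z
          rw [hR, Finset.mem_erase]
          constructor
          · rintro ⟨h1, h2, h3⟩
            exact ⟨⟨fun e => h3 s hs (e ▸ hsx), h1⟩, h2, h3⟩
          · rintro ⟨⟨h0, h1⟩, h2, h3⟩
            exact ⟨h1, h2, h3⟩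
      · push Not at hadj
        refine .shed R x ((hR x).2 ⟨hx, hxF, hadj⟩) ?_ ?_ ?_
        · refine ih1 F _ ⟨?_, hF.2⟩ ?_
          · intro u hu
            simp only [delClosedNbhd, Finset.mem_filter]
            exact ⟨hF.1 hu, fun e => hxF (e ▸ hu), fun e => hadj u hu e.symm⟩
          · intro z
            simp only [delClosedNbhd, Finset.mem_filter, hR]
            tauto
        · refine ih2 F _ ⟨?_, hF.2⟩ ?_
          · intro u hu
            exact Finset.mem_erase.2 ⟨fun e => hxF (e ▸ hu), hF.1 hu⟩
          · intro z
            simp only [Finset.mem_erase, hR]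
            tauto
        · intro S hS
          have hSR : ∀ u ∈ S, u ∈ R ∧ u ≠ x ∧ ¬ H.Adj x u := by
            intro u hu
            have := hS.1 hu
            simpa only [delClosedNbhd, Finset.mem_filter] using this
          obtain ⟨y, hyA, hxy, hy1, hy2⟩ := hexch (S ∪ F) ⟨by
              intro u hu
              simp only [delClosedNbhd, Finset.mem_filter]
              rcases Finset.mem_union.1 hu with hu | hu
              · exact ⟨((hR u).1 (hSR u hu).1).1, (hSR u hu).2⟩
              · exact ⟨hF.1 hu, fun e => hxF (e ▸ hu), fun e => hadj u hu e.symm⟩, by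
              intro u hu v hv huv
              rcases Finset.mem_union.1 hu with hu | hu <;>
                rcases Finset.mem_union.1 hv with hv | hv
              · exact hS.2 u hu v hv huv
              · exact ((hR u).1 (hSR u hu).1).2.2 v hv huv.symm
              · exact ((hR v).1 (hSR v hv).1).2.2 u hu huv
              · exact hF.2 u hu v hv huv⟩
          have hyR : y ∈ R := by
            refine (hR y).2 ⟨hyA, fun e => hadj y e hxy.symm, fun s hs => ?_⟩
            exact hy2 s (by simp [hs]) y (by simp)
          refine ⟨y, hyR, hxy, ?_, ?_⟩
          · intro u hu
            rcases Finset.mem_insert.1 hu with rfl | hu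
            · exact Finset.mem_erase.2 ⟨hxy.ne', hyR⟩
            · exact Finset.mem_erase.2 ⟨(hSR u hu).2.1, (hSR u hu).1⟩
          · intro u hu v hv
            refine hy2 u ?_ v ?_
            · rcases Finset.mem_insert.1 hu with rfl | hu <;> simp [*]
            · rcases Finset.mem_insert.1 hv with rfl | hv <;> simp [*]

open Fin.CommRing in
theorem cycle_param_aux {V : Type*} [DecidableEq V] (K : SimpleGraph V) (B : Finset V) (N : ℕ)
    (h : IsCycleGraphOn K B (N + 2)) (x : V) (hx : x ∈ B) :
    ∃ f : Fin (N + 2) → V, Function.Injective f ∧ f 0 = x ∧ (∀ z, z ∈ B ↔ ∃ a, f a = z) ∧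
      (∀ a b, K.Adj (f a) (f b) ↔ a - b = 1 ∨ b - a = 1) := by
  obtain ⟨_, ⟨e⟩⟩ := h
  have hx' : x ∈ (B : Set V) := hx
  refine ⟨fun a => (e.symm (a + e ⟨x, hx'⟩)).1, ?_, ?_, ?_, ?_⟩
  · intro a b hab
    have := e.symm.injective (Subtype.ext hab)
    exact add_right_cancel this
  · simp
  · intro z
    constructor
    · intro hz
      exact ⟨e ⟨z, hz⟩ - e ⟨x, hx'⟩, by simp⟩
    · rintro ⟨a, rfl⟩
      exact (e.symm (a + e ⟨x, hx'⟩)).2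
  · intro a b
    have := e.symm.map_adj_iff (v := a + e ⟨x, hx'⟩) (w := b + e ⟨x, hx'⟩)
    rw [SimpleGraph.cycleGraph_adj] at this
    simp only [add_sub_add_right_eq_sub] at this
    exact this

open Fin.CommRing in
theorem cycle_not_vd_aux {V : Type*} [DecidableEq V] (H : SimpleGraph V) (B : Finset V) (N : ℕ)
    (f : Fin (N + 2) → V) (hf : Function.Injective f) (hB : ∀ z, z ∈ B ↔ ∃ a, f a = z)
    (hadj : ∀ a b, H.Adj (f a) (f b) ↔ a - b = 1 ∨ b - a = 1)
    (h2 : N + 2 ≠ 2) (h3 : N + 2 ≠ 3) (h5 : N + 2 ≠ 5) : ¬ VertexDecomposableOn H B := by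
  have c2 : (2 : Fin (N + 2)) ≠ 0 := by
    intro h
    have := (Fin.natCast_eq_zero (n := N + 2) (a := 2)).1 (by exact_mod_cast h)
    have := (Nat.dvd_prime Nat.prime_two).1 this
    omega
  have c3 : (3 : Fin (N + 2)) ≠ 0 := by
    intro h
    have := (Fin.natCast_eq_zero (n := N + 2) (a := 3)).1 (by exact_mod_cast h)
    have := (Nat.dvd_prime Nat.prime_three).1 this
    omega
  have c5 : (5 : Fin (N + 2)) ≠ 0 := by
    intro h
    have := (Fin.natCast_eq_zero (n := N + 2) (a := 5)).1 (by exact_mod_cast h)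
    have := (Nat.dvd_prime Nat.prime_five).1 this
    omega
  have c1 : (1 : Fin (N + 2)) ≠ 0 := by
    intro h
    exact c2 (by linear_combination 2 * h)
  intro hvd
  cases hvd with
  | edgeless _ h =>
    exact h (f 0) ((hB _).2 ⟨_, rfl⟩) (f 1) ((hB _).2 ⟨_, rfl⟩) ((hadj _ _).2 (Or.inr (by ring)))
  | shed _ x hx hlink hdel hexch =>
    obtain ⟨k, rfl⟩ := (hB x).1 hx
    obtain ⟨y, hyB, hky, hy1, hy2⟩ := hexch {f (k + 2), f (k - 2)} ⟨by
        intro u hu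
        simp only [delClosedNbhd, Finset.mem_filter]
        simp only [Finset.mem_insert, Finset.mem_singleton] at hu
        rcases hu with rfl | rfl
        · refine ⟨(hB _).2 ⟨_, rfl⟩, fun e => c2 ?_, fun e => ?_⟩
          · linear_combination hf e
          · rcases (hadj _ _).1 e with e | e
            · exact c3 (by linear_combination -e)
            · exact c1 (by linear_combination e)
        · refine ⟨(hB _).2 ⟨_, rfl⟩, fun e => c2 ?_, fun e => ?_⟩
          · linear_combination - hf e
          · rcases (hadj _ _).1 e with e | e
            · exact c1 (by linear_combination e)
            · exact c3 (by linear_combination -e), by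
        intro u hu v hv huv
        simp only [Finset.mem_insert, Finset.mem_singleton] at hu hv
        rcases hu with rfl | rfl <;> rcases hv with rfl | rfl
        · exact huv.ne rfl
        · rcases (hadj _ _).1 huv with e | e
          · exact c3 (by linear_combination e)
          · exact c5 (by linear_combination -e)
        · rcases (hadj _ _).1 huv with e | e
          · exact c5 (by linear_combination -e)
          · exact c3 (by linear_combination e)
        · exact huv.ne rfl⟩
    obtain ⟨l, rfl⟩ := (hB y).1 hyB
    rcases (hadj _ _).1 hky with e | e
    · refine hy2 (f l) (by simp) (f (k - 2)) (by simp) ((hadj _ _).2 (Or.inl ?_))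
      linear_combination -e
    · refine hy2 (f l) (by simp) (f (k + 2)) (by simp) ((hadj _ _).2 (Or.inr ?_))
      linear_combination -e

/-- Removing a neighbour of a leaf. -/
theorem leaf_exch_aux {V : Type*} [DecidableEq V] (H : SimpleGraph V) (A : Finset V) (x y : V)
    (hy : y ∈ A) (hxy : H.Adj x y) (S : Finset V) (hS : IsIndepIn H (delClosedNbhd H A x) S)
    (hleaf : ∀ z ∈ S, ¬ H.Adj y z) :
    ∃ y ∈ A, H.Adj x y ∧ IsIndepIn H (A.erase x) (insert y S) := by
  refine ⟨y, hy, hxy, ?_, ?_⟩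
  · intro u hu
    rcases Finset.mem_insert.1 hu with rfl | hu
    · exact Finset.mem_erase.2 ⟨hxy.ne', hy⟩
    · have := hS.1 hu
      simp only [delClosedNbhd, Finset.mem_filter] at this
      exact Finset.mem_erase.2 ⟨this.2.1, this.1⟩
  · intro u hu v hv huv
    rcases Finset.mem_insert.1 hu with hu1 | hu1 <;>
      rcases Finset.mem_insert.1 hv with hv1 | hv1
    · exact huv.ne (hu1.trans hv1.symm)
    · exact hleaf v hv1 (hu1 ▸ huv)
    · exact hleaf u hu1 (hv1 ▸ huv.symm)
    · exact hS.2 u hu1 v hv1 huv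

theorem forest_vd_aux {V : Type*} [DecidableEq V] (H : SimpleGraph V) (P : V → Prop)
    (hP : ∀ A : Finset V, (∀ z ∈ A, P z) → (∃ u ∈ A, ∃ v ∈ A, H.Adj u v) →
      ∃ x ∈ A, ∃ y ∈ A, H.Adj x y ∧ ∀ z ∈ A, H.Adj y z → z = x) :
    ∀ (k : ℕ) (A : Finset V), A.card = k → (∀ z ∈ A, P z) → VertexDecomposableOn H A := by
  intro k
  induction k using Nat.strong_induction_on with
  | _ k ih =>
    intro A hk hA
    by_cases he : ∃ u ∈ A, ∃ v ∈ A, H.Adj u v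
    · obtain ⟨x, hx, y, hy, hxy, hl⟩ := hP A hA he
      have hsub : delClosedNbhd H A x ⊆ A.erase x := by
        intro z hz
        simp only [delClosedNbhd, Finset.mem_filter] at hz
        exact Finset.mem_erase.2 ⟨hz.2.1, hz.1⟩
      have hc : (A.erase x).card < k := hk ▸ Finset.card_erase_lt_of_mem hx
      refine .shed A x hx ?_ ?_ ?_
      · exact ih _ ((Finset.card_le_card hsub).trans_lt hc) _ rfl
          fun z hz => hA z (Finset.mem_of_mem_erase (hsub hz))
      · exact ih _ hc _ rfl fun z hz => hA z (Finset.mem_of_mem_erase hz)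
      · intro S hS
        refine leaf_exch_aux H A x y hy hxy S hS fun z hz hyz => ?_
        have := hsub (hS.1 hz)
        exact (Finset.mem_erase.1 this).1 (hl z (Finset.mem_of_mem_erase this) hyz)
    · push Not at he
      exact .edgeless A he

/-- Shape of a triangle or pentagon attached at `x`. -/
def ShapeAux {V : Type*} (H : SimpleGraph V) (B : Finset V) (x : V) : Prop :=
  (∃ b c, (∀ z, z ∈ B ↔ z = x ∨ z = b ∨ z = c) ∧ b ≠ x ∧ c ≠ x ∧
    (∀ z, H.Adj b z ↔ z = x ∨ z = c) ∧ (∀ z, H.Adj c z ↔ z = x ∨ z = b)) ∨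
  (∃ b c d e, (∀ z, z ∈ B ↔ z = x ∨ z = b ∨ z = c ∨ z = d ∨ z = e) ∧
    b ≠ x ∧ c ≠ x ∧ d ≠ x ∧ e ≠ x ∧
    (∀ z, H.Adj b z ↔ z = x ∨ z = c) ∧ (∀ z, H.Adj c z ↔ z = b ∨ z = d) ∧
    (∀ z, H.Adj d z ↔ z = c ∨ z = e) ∧ (∀ z, H.Adj e z ↔ z = d ∨ z = x))

theorem shape_of_cycle_aux {V : Type*} [DecidableEq V] (H K : SimpleGraph V) (B : Finset V)
    (m : ℕ) (x : V) (hx : x ∈ B) (h : IsCycleGraphOn K B m) (hm : m = 3 ∨ m = 5)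
    (hHK : ∀ y ∈ B, y ≠ x → ∀ z, H.Adj y z ↔ K.Adj y z) : ShapeAux H B x := by
  have hsupp := h.1
  rcases hm with rfl | rfl
  · left
    obtain ⟨f, hf, hf0, hB, hadj⟩ := cycle_param_aux K B 1 h x hx
    have hmem : ∀ a, f a ∈ B := fun a => (hB _).2 ⟨a, rfl⟩
    have hne : ∀ a, a ≠ 0 → f a ≠ x := fun a ha e => ha (hf (e.trans hf0.symm))
    have key : ∀ a b c : Fin 3, a ≠ 0 → (∀ d : Fin 3, (a - d = 1 ∨ d - a = 1) ↔ d = b ∨ d = c) →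
        ∀ z, H.Adj (f a) z ↔ z = f b ∨ z = f c := by
      intro a b c ha hd z
      rw [hHK _ (hmem a) (hne a ha)]
      constructor
      · intro hz
        obtain ⟨d, rfl⟩ := (hB z).1 (hsupp _ _ hz).2
        rcases (hd d).1 ((hadj _ _).1 hz) with rfl | rfl <;> simp
      · rintro (rfl | rfl)
        · exact (hadj _ _).2 ((hd _).2 (Or.inl rfl))
        · exact (hadj _ _).2 ((hd _).2 (Or.inr rfl))
    refine ⟨f 1, f 2, ?_, hne 1 (by decide), hne 2 (by decide), ?_, ?_⟩
    · intro z
      rw [hB, ← hf0]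
      constructor
      · rintro ⟨a, rfl⟩
        fin_cases a <;> simp
      · rintro (rfl | rfl | rfl) <;> exact ⟨_, rfl⟩
    · rw [← hf0]; exact key 1 0 2 (by decide) (by decide)
    · rw [← hf0]; exact key 2 0 1 (by decide) (by decide)
  · right
    obtain ⟨f, hf, hf0, hB, hadj⟩ := cycle_param_aux K B 3 h x hx
    have hmem : ∀ a, f a ∈ B := fun a => (hB _).2 ⟨a, rfl⟩
    have hne : ∀ a, a ≠ 0 → f a ≠ x := fun a ha e => ha (hf (e.trans hf0.symm))
    have key : ∀ a b c : Fin 5, a ≠ 0 → (∀ d : Fin 5, (a - d = 1 ∨ d - a = 1) ↔ d = b ∨ d = c) →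
        ∀ z, H.Adj (f a) z ↔ z = f b ∨ z = f c := by
      intro a b c ha hd z
      rw [hHK _ (hmem a) (hne a ha)]
      constructor
      · intro hz
        obtain ⟨d, rfl⟩ := (hB z).1 (hsupp _ _ hz).2
        rcases (hd d).1 ((hadj _ _).1 hz) with rfl | rfl <;> simp
      · rintro (rfl | rfl)
        · exact (hadj _ _).2 ((hd _).2 (Or.inl rfl))
        · exact (hadj _ _).2 ((hd _).2 (Or.inr rfl))
    refine ⟨f 1, f 2, f 3, f 4, ?_, hne 1 (by decide), hne 2 (by decide), hne 3 (by decide),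
      hne 4 (by decide), ?_, ?_, ?_, ?_⟩
    · intro z
      rw [hB, ← hf0]
      constructor
      · rintro ⟨a, rfl⟩
        fin_cases a <;> simp
      · rintro (rfl | rfl | rfl | rfl | rfl) <;> exact ⟨_, rfl⟩
    · rw [← hf0]; exact key 1 0 2 (by decide) (by decide)
    · exact key 2 1 3 (by decide) (by decide)
    · exact key 3 2 4 (by decide) (by decide)
    · rw [← hf0]; exact key 4 3 0 (by decide) (by decide)

theorem shape_leaf_aux {V : Type*} [DecidableEq V] (H : SimpleGraph V) (B : Finset V) (x : V)
    (h : ShapeAux H B x) (A : Finset V) (hxA : x ∉ A) (u v : V) (hu : u ∈ A) (hv : v ∈ A)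
    (huB : u ∈ B) (huv : H.Adj u v) :
    ∃ x ∈ A, ∃ y ∈ A, H.Adj x y ∧ ∀ z ∈ A, H.Adj y z → z = x := by
  have nx : ∀ z ∈ A, z ≠ x := fun z hz e => hxA (e ▸ hz)
  have nu := nx u hu
  have nv := nx v hv
  rcases h with ⟨b, c, hB, hb, hc, ab, ac⟩ | ⟨b, c, d, e, hB, hb, hc, hd, he, ab, ac, ad, ae⟩
  · refine ⟨u, hu, v, hv, huv, fun z hz hvz => ?_⟩
    have nz := nx z hz
    rcases (hB u).1 huB with rfl | rfl | rfl
    · exact absurd rfl nu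
    · have := (ab v).1 huv
      simp only [nv, false_or] at this
      subst this
      simpa [nz] using (ac z).1 hvz
    · have := (ac v).1 huv
      simp only [nv, false_or] at this
      subst this
      simpa [nz] using (ab z).1 hvz
  · have Lb : b ∈ A → c ∈ A → ∃ x ∈ A, ∃ y ∈ A, H.Adj x y ∧ ∀ z ∈ A, H.Adj y z → z = x :=
      fun h1 h2 => ⟨c, h2, b, h1, (ac b).2 (Or.inl rfl), fun z hz hh =>
        ((ab z).1 hh).resolve_left (nx z hz)⟩
    have Le : e ∈ A → d ∈ A → ∃ x ∈ A, ∃ y ∈ A, H.Adj x y ∧ ∀ z ∈ A, H.Adj y z → z = x :=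
      fun h1 h2 => ⟨d, h2, e, h1, (ad e).2 (Or.inr rfl), fun z hz hh =>
        ((ae z).1 hh).resolve_right (nx z hz)⟩
    have Lc : c ∈ A → d ∈ A → ∃ x ∈ A, ∃ y ∈ A, H.Adj x y ∧ ∀ z ∈ A, H.Adj y z → z = x := by
      intro h1 h2
      by_cases hbA : b ∈ A
      · exact Lb hbA h1
      · refine ⟨d, h2, c, h1, (ad c).2 (Or.inl rfl), fun z hz hh => ?_⟩
        exact ((ac z).1 hh).resolve_left fun e => hbA (e ▸ hz)
    rcases (hB u).1 huB with rfl | rfl | rfl | rfl | rfl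
    · exact absurd rfl nu
    · rcases (ab v).1 huv with rfl | rfl
      · exact absurd rfl nv
      · exact Lb hu hv
    · rcases (ac v).1 huv with rfl | rfl
      · exact Lb hv hu
      · exact Lc hu hv
    · rcases (ad v).1 huv with rfl | rfl
      · exact Lc hv hu
      · exact Le hv hu
    · rcases (ae v).1 huv with rfl | rfl
      · exact Le hu hv
      · exact absurd rfl nv

theorem shape_exch_aux {V : Type*} [DecidableEq V] (H : SimpleGraph V) (B : Finset V) (x : V)
    (h : ShapeAux H B x) (A : Finset V) (hBA : B ⊆ A) (S : Finset V)
    (hS : IsIndepIn H (delClosedNbhd H A x) S) :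
    ∃ y ∈ A, H.Adj x y ∧ IsIndepIn H (A.erase x) (insert y S) := by
  have hS' : ∀ z ∈ S, z ≠ x ∧ ¬ H.Adj x z := by
    intro z hz
    have := hS.1 hz
    simp only [delClosedNbhd, Finset.mem_filter] at this
    exact this.2
  rcases h with ⟨b, c, hB, hb, hc, ab, ac⟩ | ⟨b, c, d, e, hB, hb, hc, hd, he, ab, ac, ad, ae⟩
  · refine leaf_exch_aux H A x b (hBA ((hB b).2 (by simp))) ((ab x).2 (by simp)).symm S hS ?_
    intro z hz hbz
    rcases (ab z).1 hbz with rfl | rfl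
    · exact (hS' _ hz).1 rfl
    · exact (hS' _ hz).2 ((ac x).2 (by simp)).symm
  · by_cases hcS : c ∈ S
    · refine leaf_exch_aux H A x e (hBA ((hB e).2 (by simp))) ((ae x).2 (by simp)).symm S hS ?_
      intro z hz hez
      rcases (ae z).1 hez with rfl | rfl
      · exact hS.2 _ hcS _ hz ((ac _).2 (by simp))
      · exact (hS' _ hz).1 rfl
    · refine leaf_exch_aux H A x b (hBA ((hB b).2 (by simp))) ((ab x).2 (by simp)).symm S hS ?_
      intro z hz hbz
      rcases (ab z).1 hbz with rfl | rfl
      · exact (hS' _ hz).1 rfl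
      · exact hcS hz

theorem attach_vd_aux {V : Type*} [DecidableEq V] (n : ℕ) (x : Fin n → V) (B : Fin n → Finset V)
    (H : SimpleGraph V) (hxinj : Function.Injective x) (hxB : ∀ i, x i ∈ B i)
    (huniq : ∀ i j z, z ∈ B i → z ∈ B j → i = j)
    (hnb : ∀ i, ∀ y ∈ B i, y ≠ x i → ∀ z, H.Adj y z → z ∈ B i)
    (hsh : ∀ i, ShapeAux H (B i) (x i)) :
    ∀ (k : ℕ) (A : Finset V), A.card = k → A ⊆ Finset.univ.biUnion B →
      (∀ i, x i ∈ A → B i ⊆ A) → VertexDecomposableOn H A := by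
  intro k
  induction k using Nat.strong_induction_on with
  | _ k ih =>
    intro A hk hAB hfull
    by_cases hi : ∃ i, x i ∈ A
    · obtain ⟨i, hi⟩ := hi
      have hsub : delClosedNbhd H A (x i) ⊆ A.erase (x i) := by
        intro z hz
        simp only [delClosedNbhd, Finset.mem_filter] at hz
        exact Finset.mem_erase.2 ⟨hz.2.1, hz.1⟩
      have hc : (A.erase (x i)).card < k := hk ▸ Finset.card_erase_lt_of_mem hi
      have hnotin : ∀ j, j ≠ i → x i ∉ B j := fun j hj h => hj (huniq j i _ h (hxB i))
      refine .shed A (x i) hi ?_ ?_ ?_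
      · refine ih _ ((Finset.card_le_card hsub).trans_lt hc) _ rfl
          (hsub.trans ((Finset.erase_subset _ _).trans hAB)) ?_
        intro j hj y hy
        simp only [delClosedNbhd, Finset.mem_filter] at hj ⊢
        have hji : j ≠ i := fun e => hj.2.1 (by rw [e])
        refine ⟨hfull j hj.1 hy, fun e => hnotin j hji (e ▸ hy), fun e => ?_⟩
        by_cases hyj : y = x j
        · exact hj.2.2 (hyj ▸ e)
        · exact hnotin j hji (hnb j y hy hyj _ e.symm)
      · refine ih _ hc _ rfl ((Finset.erase_subset _ _).trans hAB) ?_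
        intro j hj y hy
        rw [Finset.mem_erase] at hj ⊢
        have hji : j ≠ i := fun e => hj.1 (by rw [e])
        exact ⟨fun e => hnotin j hji (e ▸ hy), hfull j hj.2 hy⟩
      · exact fun S hS => shape_exch_aux H (B i) (x i) (hsh i) A (hfull i hi) S hS
    · push Not at hi
      refine forest_vd_aux H (fun z => z ∈ Finset.univ.biUnion B ∧ ∀ i, z ≠ x i) ?_ _ A rfl
        fun z hz => ⟨hAB hz, fun i e => hi i (e ▸ hz)⟩
      rintro A' hA' ⟨u, hu, v, hv, huv⟩
      obtain ⟨j, -, huj⟩ := Finset.mem_biUnion.1 (hA' u hu).1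
      exact shape_leaf_aux H (B j) (x j) (hsh j) A' (fun h => (hA' _ h).2 j rfl) u v hu hv huj huv

theorem attach_cycle_vd_aux {V : Type*} [DecidableEq V] (n : ℕ) (x : Fin n → V)
    (B : Fin n → Finset V) (H : SimpleGraph V) (hxB : ∀ i, x i ∈ B i)
    (huniq : ∀ i j z, z ∈ B i → z ∈ B j → i = j)
    (hnb : ∀ i, ∀ y ∈ B i, y ≠ x i → ∀ z, H.Adj y z → z ∈ B i)
    (y : Fin n → V) (hyB : ∀ i, y i ∈ B i) (hy : ∀ i, H.Adj (x i) (y i))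
    (hvd : VertexDecomposableOn H (Finset.univ.biUnion B)) (i : Fin n) :
    VertexDecomposableOn H (B i) := by
  classical
  let A := Finset.univ.biUnion B
  let Q : Finset V → Prop := fun F => IsIndepIn H A F ∧ (∀ j, x j ∉ F) ∧ (∀ z ∈ F, z ∉ B i) ∧
    ∀ j, j ≠ i → y j ∈ F
  have memA : ∀ j, ∀ z ∈ B j, z ∈ A := fun j z hz =>
    Finset.mem_biUnion.2 ⟨j, Finset.mem_univ _, hz⟩
  have hyx : ∀ j k, y j ≠ x k := by
    intro j k e
    have hjk := huniq j k (y j) (hyB j) (e ▸ hxB k)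
    subst hjk
    exact (hy j).ne e.symm
  have h0 : Q ((Finset.univ.erase i).image y) := by
    refine ⟨⟨?_, ?_⟩, ?_, ?_, ?_⟩
    · intro z hz
      obtain ⟨j, _, rfl⟩ := Finset.mem_image.1 hz
      exact memA j _ (hyB j)
    · intro u hu v hv huv
      obtain ⟨j, _, rfl⟩ := Finset.mem_image.1 hu
      obtain ⟨k, _, rfl⟩ := Finset.mem_image.1 hv
      have := huniq _ _ _ (hnb j _ (hyB j) (hyx j j) _ huv) (hyB k)
      subst this
      exact huv.ne rfl
    · intro j hj
      obtain ⟨k, _, e⟩ := Finset.mem_image.1 hj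
      exact hyx _ _ e
    · intro z hz hzi
      obtain ⟨j, hj, rfl⟩ := Finset.mem_image.1 hz
      exact (Finset.mem_erase.1 hj).1 (huniq _ _ _ (hyB j) hzi)
    · intro j hj
      exact Finset.mem_image.2 ⟨j, by simp [hj], rfl⟩
  obtain ⟨F, hFm, hmax⟩ := Finset.exists_max_image (A.powerset.filter Q) Finset.card
    ⟨_, Finset.mem_filter.2 ⟨Finset.mem_powerset.2 h0.1.1, h0⟩⟩
  have hF : Q F := (Finset.mem_filter.1 hFm).2
  refine vd_link_aux H A hvd F (B i) hF.1 ?_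
  intro z
  constructor
  · intro hz
    refine ⟨memA i z hz, fun h => hF.2.2.1 z h hz, fun s hs hsz => ?_⟩
    obtain ⟨j, -, hsj⟩ := Finset.mem_biUnion.1 (hF.1.1 hs)
    have hzj := hnb j s hsj (fun e => hF.2.1 j (e ▸ hs)) z hsz
    have := huniq _ _ _ hz hzj
    subst this
    exact hF.2.2.1 s hs hsj
  · rintro ⟨hzA, hzF, hzadj⟩
    by_contra hzi
    obtain ⟨j, -, hzj⟩ := Finset.mem_biUnion.1 hzA
    have hji : j ≠ i := fun e => hzi (e ▸ hzj)
    have hzx : ∀ k, x k ≠ z := by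
      rintro k rfl
      have := huniq _ _ _ (hxB k) hzj
      subst this
      exact hzadj _ (hF.2.2.2 _ hji) (hy k).symm
    have hQ : Q (insert z F) := by
      refine ⟨⟨Finset.insert_subset hzA hF.1.1, ?_⟩, ?_, ?_, ?_⟩
      · intro u hu v hv huv
        rcases Finset.mem_insert.1 hu with hu1 | hu1 <;>
          rcases Finset.mem_insert.1 hv with hv1 | hv1
        · exact huv.ne (hu1.trans hv1.symm)
        · exact hzadj v hv1 (hu1 ▸ huv.symm)
        · exact hzadj u hu1 (hv1 ▸ huv)
        · exact hF.1.2 u hu1 v hv1 huv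
      · intro k hk
        rcases Finset.mem_insert.1 hk with e | hk
        · exact hzx k e
        · exact hF.2.1 k hk
      · intro w hw
        rcases Finset.mem_insert.1 hw with rfl | hw
        · exact hzi
        · exact hF.2.2.1 w hw
      · intro k hk
        exact Finset.mem_insert_of_mem (hF.2.2.2 k hk)
    have := hmax _ (Finset.mem_filter.2 ⟨Finset.mem_powerset.2 hQ.1.1, hQ⟩)
    rw [Finset.card_insert_of_notMem hzF] at this
    omega

/-- The graph obtained by attaching a cycle of length `m i ≥ 3` to each
vertex of `G` is vertex decomposable iff every `m i` is `3` or `5`. -/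
theorem stmt_6 {V : Type*} [DecidableEq V] (n : ℕ) (x : Fin n → V) (B : Fin n → Finset V)
    (G : SimpleGraph V) (Gs : Fin n → SimpleGraph V) (m : Fin n → ℕ)
    (hxinj : Function.Injective x)
    (hGsupp : ∀ u v, G.Adj u v → (∃ i, u = x i) ∧ (∃ j, v = x j))
    (hxB : ∀ i, x i ∈ B i)
    (hBdisj : ∀ i j, i ≠ j → Disjoint (B i) (B j))
    (hm : ∀ i, 3 ≤ m i)
    -- each `Gs i` is a cycle graph of length `m i` on the vertex set `B i`
    (hcyc : ∀ i, IsCycleGraphOn (Gs i) (B i) (m i)) :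
    VertexDecomposableOn (G ⊔ ⨆ i, Gs i) (Finset.univ.biUnion B) ↔
      ∀ i, m i = 3 ∨ m i = 5 := by
  have huniq : ∀ i j z, z ∈ B i → z ∈ B j → i = j := by
    intro i j z hi hj
    by_contra hij
    exact Finset.disjoint_left.1 (hBdisj i j hij) hi hj
  have hHadj : ∀ u v, (G ⊔ ⨆ i, Gs i).Adj u v ↔ G.Adj u v ∨ ∃ i, (Gs i).Adj u v := by
    intro u v
    simp [SimpleGraph.sup_adj, SimpleGraph.iSup_adj]
  generalize (G ⊔ ⨆ i, Gs i) = H at hHadj ⊢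
  have hnon : ∀ i, ∀ y ∈ B i, y ≠ x i → ∀ z, H.Adj y z ↔ (Gs i).Adj y z := by
    intro i y hy hyx z
    rw [hHadj]
    constructor
    · rintro (h | ⟨j, h⟩)
      · obtain ⟨⟨k, rfl⟩, -⟩ := hGsupp _ _ h
        have := huniq _ _ _ hy (hxB k)
        subst this
        exact absurd rfl hyx
      · have := huniq _ _ _ hy ((hcyc j).1 _ _ h).1
        subst this
        exact h
    · exact fun h => Or.inr ⟨i, h⟩
  have hnb : ∀ i, ∀ y ∈ B i, y ≠ x i → ∀ z, H.Adj y z → z ∈ B i := fun i y hy hyx z h =>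
    ((hcyc i).1 _ _ ((hnon i y hy hyx z).1 h)).2
  have hin : ∀ i, ∀ u ∈ B i, ∀ v ∈ B i, (H.Adj u v ↔ (Gs i).Adj u v) := by
    intro i u hu v hv
    by_cases hux : u = x i
    · by_cases hvx : v = x i
      · rw [hux, hvx]; simp
      · rw [H.adj_comm, (Gs i).adj_comm]
        exact hnon i v hv hvx u
    · exact hnon i u hu hux v
  have hpar : ∀ i, ∃ N, m i = N + 2 ∧ ∃ f : Fin (N + 2) → V, Function.Injective f ∧ f 0 = x i ∧
      (∀ z, z ∈ B i ↔ ∃ a, f a = z) ∧ (∀ a b, H.Adj (f a) (f b) ↔ a - b = 1 ∨ b - a = 1) := by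
    intro i
    obtain ⟨N, hN⟩ : ∃ N, m i = N + 2 := ⟨m i - 2, by have := hm i; omega⟩
    obtain ⟨f, h1, h2, h3, h4⟩ := cycle_param_aux (Gs i) (B i) N (hN ▸ hcyc i) (x i) (hxB i)
    exact ⟨N, hN, f, h1, h2, h3, fun a b => by
      rw [hin i _ ((h3 _).2 ⟨a, rfl⟩) _ ((h3 _).2 ⟨b, rfl⟩), h4]⟩
  constructor
  · intro hvd i
    have hy : ∀ j, ∃ y, y ∈ B j ∧ H.Adj (x j) y := by
      intro j
      obtain ⟨N, _, f, h1, h2, h3, h4⟩ := hpar j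
      refine ⟨f 1, (h3 _).2 ⟨_, rfl⟩, ?_⟩
      rw [← h2, h4]
      simp
    choose y hyB hy using hy
    have hBi := attach_cycle_vd_aux n x B H hxB huniq hnb y hyB hy hvd i
    obtain ⟨N, hN, f, h1, h2, h3, h4⟩ := hpar i
    by_contra hcon
    have := hm i
    exact cycle_not_vd_aux H (B i) N f h1 h3 h4 (by omega) (by omega) (by omega) hBi
  · intro h35
    refine attach_vd_aux n x B H hxinj hxB huniq hnb (fun i => ?_) _ _ rfl subset_rfl ?_
    · exact shape_of_cycle_aux H (Gs i) (B i) (m i) (x i) (hxB i) (hcyc i) (h35 i) (hnon i)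
    · intro i _ z hz
      exact Finset.mem_biUnion.2 ⟨i, Finset.mem_univ _, hz⟩
end

section
/- Let G be a finite simple graph on vertex set {x_{11}, …, x_{n1}}, let m_1, …, m_n ≥ 3 be integers, and for each i let C_{m_i} be a cycle graph of length m_i containing the vertex x_{i1}. Then the attachment graph G(C_{m_1}, …, C_{m_n}) is shellable if and only if m_i ∈ {3, 5} for all i = 1, …, n. -/
variable {V : Type*} [DecidableEq V]

section Helpers

variable {H : SimpleGraph V} {A : Finset V}

lemma maxIndep_iff_aux {S : Finset V} (h : IsMaxIndepIn H A S) :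
    ∀ v ∈ A, v ∉ S → ∃ u ∈ S, H.Adj u v := by
  classical
  intro v hv hvS
  by_contra hcon
  push Not at hcon
  have := h.2 (insert v S) ⟨by
    intro a ha
    rcases Finset.mem_insert.1 ha with rfl | ha
    · exact hv
    · exact h.1.1 ha, by
    intro a ha b hb hab
    rcases Finset.mem_insert.1 ha with ha1 | ha1 <;>
      rcases Finset.mem_insert.1 hb with hb1 | hb1
    · exact hab.ne (ha1.trans hb1.symm)
    · exact hcon b hb1 (ha1 ▸ hab.symm)
    · exact hcon a ha1 (hb1 ▸ hab)
    · exact h.1.2 a ha1 b hb1 hab⟩ (Finset.subset_insert _ _)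
  exact hvS (this ▸ Finset.mem_insert_self v S)

lemma maxIndep_of {S : Finset V} (h : IsIndepIn H A S)
    (h2 : ∀ v ∈ A, v ∉ S → ∃ u ∈ S, H.Adj u v) : IsMaxIndepIn H A S := by
  refine ⟨h, fun T hT hST => Finset.Subset.antisymm hST fun v hv => ?_⟩
  by_contra hvS
  obtain ⟨u, hu, huv⟩ := h2 v (hT.1 hv) hvS
  exact hT.2 u (hST hu) v hv huv

lemma exists_maxIndep {S : Finset V} (h : IsIndepIn H A S) :
    ∃ T, S ⊆ T ∧ IsMaxIndepIn H A T := by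
  classical
  obtain ⟨T, hT, hmax⟩ := Finset.exists_max_image
    (A.powerset.filter fun T => S ⊆ T ∧ IsIndepIn H A T) Finset.card
    ⟨S, by simp [h, h.1]⟩
  simp only [Finset.mem_filter, Finset.mem_powerset] at hT hmax
  refine ⟨T, hT.2.1, hT.2.2, fun U hU hTU => ?_⟩
  exact Finset.eq_of_subset_of_card_le hTU (hmax U ⟨hU.1, hT.2.1.trans hTU, hU⟩)

/-- Shellability by means of a rank function on facets. -/
def RankShell (H : SimpleGraph V) (A : Finset V) : Prop :=
  ∃ pos : Finset V → ℕ,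
    (∀ F F', IsMaxIndepIn H A F → IsMaxIndepIn H A F' → pos F = pos F' → F = F') ∧
    ∀ F F', IsMaxIndepIn H A F → IsMaxIndepIn H A F' → pos F' < pos F →
      ∃ v ∈ F, v ∉ F' ∧ ∃ F'', IsMaxIndepIn H A F'' ∧ pos F'' < pos F ∧ F.erase v ⊆ F''

lemma rankShell_of_shellable (h : ShellableOn H A) : RankShell H A := by
  classical
  obtain ⟨t, F, hinj, hF, hsh⟩ := h
  let pos : Finset V → ℕ := fun S => if h : ∃ i, F i = S then (h.choose).val else 0
  have hpos : ∀ i, pos (F i) = i.val := by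
    intro i
    have hex : ∃ j, F j = F i := ⟨i, rfl⟩
    have : pos (F i) = (hex.choose).val := dif_pos hex
    rw [this, hinj hex.choose_spec]
  refine ⟨pos, ?_, ?_⟩
  · intro S S' hS hS' he
    obtain ⟨i, rfl⟩ := (hF S).1 hS
    obtain ⟨j, rfl⟩ := (hF S').1 hS'
    rw [hpos, hpos] at he
    rw [Fin.ext he]
  · intro S S' hS hS' hlt
    obtain ⟨i, rfl⟩ := (hF S).1 hS
    obtain ⟨j, rfl⟩ := (hF S').1 hS'
    rw [hpos, hpos] at hlt
    obtain ⟨T, hT1, hT2, ⟨l, hl, hTl⟩, hcard⟩ := hsh i (F i ∩ F j) Finset.inter_subset_left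
      ⟨j, hlt, Finset.inter_subset_right⟩
    have hne : ∃ v ∈ F i, v ∉ T := by
      by_contra hcon
      push Not at hcon
      have : F i ⊆ F l := fun v hv => hTl (hcon v hv)
      have := hS.2 (F l) ((hF _).2 ⟨l, rfl⟩).1 this
      exact hl.ne' (hinj this)
    obtain ⟨v, hv, hvT⟩ := hne
    have hTe : T = (F i).erase v := by
      apply Finset.eq_of_subset_of_card_le
      · intro w hw
        exact Finset.mem_erase.2 ⟨fun h => hvT (h ▸ hw), hT2 hw⟩
      · rw [Finset.card_erase_of_mem hv, hcard]
    refine ⟨v, hv, fun hvj => hvT (hT1 (Finset.mem_inter.2 ⟨hv, hvj⟩)), F l,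
      (hF _).2 ⟨l, rfl⟩, by rw [hpos, hpos]; exact hl, hTe ▸ hTl⟩

lemma shellable_of_rankShell (h : RankShell H A) : ShellableOn H A := by
  classical
  obtain ⟨pos, hinj, hsh⟩ := h
  let Fs : Finset (Finset V) := A.powerset.filter fun S => IsMaxIndepIn H A S
  have hFs : ∀ S, S ∈ Fs ↔ IsMaxIndepIn H A S := by
    intro S
    simp only [Fs, Finset.mem_filter, Finset.mem_powerset]
    exact ⟨fun h => h.2, fun h => ⟨h.1.1, h⟩⟩
  let P : Finset ℕ := Fs.image pos
  let e := P.orderEmbOfFin rfl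
  have he : ∀ i, ∃ S, IsMaxIndepIn H A S ∧ pos S = e i := by
    intro i
    have : e i ∈ P := Finset.orderEmbOfFin_mem _ _ _
    obtain ⟨S, hS, h⟩ := Finset.mem_image.1 this
    exact ⟨S, (hFs S).1 hS, h⟩
  choose F hF1 hF2 using he
  have hsur : ∀ S, IsMaxIndepIn H A S → ∃ i, F i = S := by
    intro S hS
    have h1 : pos S ∈ P := Finset.mem_image_of_mem _ ((hFs S).2 hS)
    have h2 : pos S ∈ Set.range e := by
      rw [Finset.range_orderEmbOfFin]; exact h1
    obtain ⟨i, hi⟩ := h2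
    exact ⟨i, hinj _ _ (hF1 i) hS (by rw [hF2, hi])⟩
  refine ⟨P.card, F, ?_, ?_, ?_⟩
  · intro i j hij
    apply e.injective
    rw [← hF2, ← hF2, hij]
  · exact fun S => ⟨hsur S, fun ⟨i, hi⟩ => hi ▸ hF1 i⟩
  · rintro i S hS ⟨j, hj, hSj⟩
    obtain ⟨v, hv, hvj, F'', hF'', hlt, hsub⟩ := hsh (F i) (F j) (hF1 i) (hF1 j)
      (by rw [hF2, hF2]; exact e.strictMono hj)
    obtain ⟨l, rfl⟩ := hsur F'' hF''
    refine ⟨(F i).erase v, ?_, Finset.erase_subset _ _, ⟨l, ?_, hsub⟩,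
      Finset.card_erase_of_mem hv⟩
    · intro w hw
      exact Finset.mem_erase.2 ⟨fun h => hvj (h ▸ hSj hw), hS hw⟩
    · rw [hF2, hF2] at hlt
      exact e.lt_iff_lt.1 hlt

/-- `C` is the vertex set of the link of `R`. -/
def IsLink (H : SimpleGraph V) (A R C : Finset V) : Prop :=
  ∀ v, v ∈ C ↔ v ∈ A ∧ v ∉ R ∧ ∀ u ∈ R, ¬H.Adj u v

lemma link_facet {R C M : Finset V} (hR : IsIndepIn H A R) (hC : IsLink H A R C) (hM : IsMaxIndepIn H C M) :
    IsMaxIndepIn H A (M ∪ R) := by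
  refine maxIndep_of ⟨?_, ?_⟩ ?_
  · intro v hv
    rcases Finset.mem_union.1 hv with hv | hv
    · exact ((hC v).1 (hM.1.1 hv)).1
    · exact hR.1 hv
  · intro u hu v hv huv
    rcases Finset.mem_union.1 hu with hu | hu <;> rcases Finset.mem_union.1 hv with hv | hv
    · exact hM.1.2 u hu v hv huv
    · exact ((hC u).1 (hM.1.1 hu)).2.2 v hv huv.symm
    · exact ((hC v).1 (hM.1.1 hv)).2.2 u hu huv
    · exact hR.2 u hu v hv huv
  · intro v hv hvn
    simp only [Finset.mem_union, not_or] at hvn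
    by_cases h : v ∈ C
    · obtain ⟨u, hu, huv⟩ := maxIndep_iff_aux hM v h hvn.1
      exact ⟨u, Finset.mem_union_left _ hu, huv⟩
    · rw [hC] at h
      push Not at h
      obtain ⟨u, hu, huv⟩ := h hv hvn.2
      exact ⟨u, Finset.mem_union_right _ hu, huv⟩

lemma facet_link {R C F : Finset V} (hC : IsLink H A R C) (hF : IsMaxIndepIn H A F)
    (hRF : R ⊆ F) : IsMaxIndepIn H C (F \ R) := by
  refine maxIndep_of ⟨?_, ?_⟩ ?_
  · intro v hv
    rw [Finset.mem_sdiff] at hv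
    exact (hC v).2 ⟨hF.1.1 hv.1, hv.2, fun u hu => hF.1.2 u (hRF hu) v hv.1⟩
  · intro u hu v hv
    exact hF.1.2 u (Finset.mem_sdiff.1 hu).1 v (Finset.mem_sdiff.1 hv).1
  · intro v hv hvn
    have hv' := (hC v).1 hv
    have : v ∉ F := fun h => hvn (Finset.mem_sdiff.2 ⟨h, hv'.2.1⟩)
    obtain ⟨u, hu, huv⟩ := maxIndep_iff_aux hF v hv'.1 this
    exact ⟨u, Finset.mem_sdiff.2 ⟨hu, fun h => hv'.2.2 u h huv⟩, huv⟩

lemma link_disj {R C M : Finset V} (hC : IsLink H A R C) (hM : IsMaxIndepIn H C M) :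
    (M ∪ R) \ R = M := by
  ext v
  simp only [Finset.mem_sdiff, Finset.mem_union]
  constructor
  · tauto
  · intro h
    exact ⟨Or.inl h, ((hC v).1 (hM.1.1 h)).2.1⟩

lemma rankShell_link {R C : Finset V} (hR : IsIndepIn H A R) (hC : IsLink H A R C)
    (h : RankShell H A) : RankShell H C := by
  obtain ⟨pos, hinj, hsh⟩ := h
  refine ⟨fun M => pos (M ∪ R), ?_, ?_⟩
  · intro M M' hM hM' he
    have := hinj _ _ (link_facet hR hC hM) (link_facet hR hC hM') he
    rw [← link_disj hC hM, this, link_disj hC hM']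
  · intro M M' hM hM' hlt
    obtain ⟨v, hv, hv', F, hF, hlt2, hsub⟩ :=
      hsh _ _ (link_facet hR hC hM) (link_facet hR hC hM') hlt
    simp only [Finset.mem_union, not_or] at hv hv'
    have hRF : R ⊆ F := fun w hw => hsub (Finset.mem_erase.2
      ⟨fun h => hv'.2 (h ▸ hw), Finset.mem_union_right _ hw⟩)
    have hvM : v ∈ M := hv.resolve_right hv'.2
    refine ⟨v, hvM, hv'.1, F \ R, facet_link hC hF hRF, ?_, ?_⟩
    · simp only
      rw [Finset.sdiff_union_of_subset hRF]; exact hlt2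
    · intro w hw
      have hw' := Finset.mem_erase.1 hw
      exact Finset.mem_sdiff.2 ⟨hsub (Finset.mem_erase.2 ⟨hw'.1, Finset.mem_union_left _ hw'.2⟩),
        ((hC w).1 (hM.1.1 hw'.2)).2.1⟩

lemma rankShell_shed {x : V} {C : Finset V} (hx : x ∈ A) (hC : IsLink H A {x} C)
    (hlink : RankShell H C) (hdel : RankShell H (A.erase x))
    (hshed : ∀ S, IsIndepIn H C S → ∃ y ∈ A, H.Adj x y ∧ ∀ u ∈ S, ¬ H.Adj u y) :
    RankShell H A := by
  classical
  obtain ⟨p1, hp1, hs1⟩ := hdel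
  obtain ⟨p2, hp2, hs2⟩ := hlink
  have hR : IsIndepIn H A {x} := ⟨by simpa using hx, by simp⟩
  have hxF : ∀ F, x ∈ F → ({x} : Finset V) ⊆ F := fun F h => by simpa using h
  -- facets without x
  have hd1 : ∀ F, IsMaxIndepIn H A F → x ∉ F → IsMaxIndepIn H (A.erase x) F := by
    intro F hF hxF
    refine maxIndep_of ⟨fun v hv => Finset.mem_erase.2 ⟨fun h => hxF (h ▸ hv), hF.1.1 hv⟩,
      hF.1.2⟩ ?_
    intro v hv hvF
    exact maxIndep_iff_aux hF v (Finset.mem_of_mem_erase hv) hvF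
  have hd2 : ∀ F, IsMaxIndepIn H (A.erase x) F → IsMaxIndepIn H A F ∧ x ∉ F := by
    intro F hF
    have hxF : x ∉ F := fun h => by simpa using hF.1.1 h
    refine ⟨maxIndep_of ⟨hF.1.1.trans (Finset.erase_subset _ _), hF.1.2⟩ ?_, hxF⟩
    intro v hv hvF
    by_cases hvx : v = x
    · subst hvx
      by_contra hcon
      push Not at hcon
      have hFC : IsIndepIn H C F := by
        refine ⟨fun w hw => (hC w).2 ⟨Finset.mem_of_mem_erase (hF.1.1 hw), ?_, ?_⟩, hF.1.2⟩
        · simp only [Finset.mem_singleton]; rintro rfl; exact hxF hw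
        · simp only [Finset.mem_singleton]; rintro u rfl hu; exact hcon w hw hu.symm
      obtain ⟨y, hyA, hxy, hy⟩ := hshed F hFC
      by_cases hyF : y ∈ F
      · exact hcon y hyF hxy.symm
      · obtain ⟨u, hu, huy⟩ := maxIndep_iff_aux hF y (Finset.mem_erase.2 ⟨hxy.ne', hyA⟩) hyF
        exact hy u hu huy
    · exact maxIndep_iff_aux hF v (Finset.mem_erase.2 ⟨hvx, hv⟩) hvF
  let N := A.powerset.sup p1 + 1
  have hN : ∀ F, IsMaxIndepIn H A F → p1 F < N := fun F hF =>
    Nat.lt_succ_of_le (Finset.le_sup (f := p1) (Finset.mem_powerset.2 hF.1.1))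
  let pos : Finset V → ℕ := fun F => if x ∈ F then N + p2 (F \ {x}) else p1 F
  have pos1 : ∀ F, x ∈ F → pos F = N + p2 (F \ {x}) := fun F h => if_pos h
  have pos2 : ∀ F, x ∉ F → pos F = p1 F := fun F h => if_neg h
  refine ⟨pos, ?_, ?_⟩
  · intro F F' hF hF' he
    have h1 := hN F hF
    have h2 := hN F' hF'
    by_cases hx1 : x ∈ F <;> by_cases hx2 : x ∈ F'
    · rw [pos1 F hx1, pos1 F' hx2] at he
      have := hp2 _ _ (facet_link hC hF (hxF F hx1)) (facet_link hC hF' (hxF F' hx2)) (by omega)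
      rw [← Finset.sdiff_union_of_subset (hxF F hx1), this,
        Finset.sdiff_union_of_subset (hxF F' hx2)]
    · rw [pos1 F hx1, pos2 F' hx2] at he
      omega
    · rw [pos2 F hx1, pos1 F' hx2] at he
      omega
    · rw [pos2 F hx1, pos2 F' hx2] at he
      exact hp1 _ _ (hd1 F hF hx1) (hd1 F' hF' hx2) he
  · intro F F' hF hF' hlt
    have h1 := hN F hF
    by_cases hx1 : x ∈ F
    · by_cases hx2 : x ∈ F'
      · rw [pos1 F hx1, pos1 F' hx2] at hlt
        obtain ⟨v, hv, hv', M, hM, hltM, hsub⟩ := hs2 _ _ (facet_link hC hF (hxF F hx1))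
          (facet_link hC hF' (hxF F' hx2)) (by omega)
        simp only [Finset.mem_sdiff, Finset.mem_singleton] at hv hv'
        refine ⟨v, hv.1, fun h => hv' ⟨h, hv.2⟩, M ∪ {x}, link_facet hR hC hM, ?_, ?_⟩
        · rw [pos1 F hx1, pos1 _ (by simp), link_disj hC hM]
          omega
        · intro w hw
          have hw' := Finset.mem_erase.1 hw
          by_cases hwx : w = x
          · simp [hwx]
          · exact Finset.mem_union_left _ (hsub (by simp [hw'.1, hw'.2, hwx]))
      · have hind : IsIndepIn H (A.erase x) (F.erase x) :=
          ⟨Finset.erase_subset_erase _ hF.1.1, fun u hu v hv =>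
            hF.1.2 u (Finset.mem_of_mem_erase hu) v (Finset.mem_of_mem_erase hv)⟩
        obtain ⟨T, hT, hTm⟩ := exists_maxIndep hind
        refine ⟨x, hx1, hx2, T, (hd2 T hTm).1, ?_, hT⟩
        rw [pos1 F hx1, pos2 T (hd2 T hTm).2]
        have := hN T (hd2 T hTm).1
        omega
    · by_cases hx2 : x ∈ F'
      · rw [pos2 F hx1, pos1 F' hx2] at hlt
        omega
      · rw [pos2 F hx1, pos2 F' hx2] at hlt
        obtain ⟨v, hv, hv', T, hT, hltT, hsub⟩ := hs1 _ _ (hd1 F hF hx1) (hd1 F' hF' hx2) hlt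
        refine ⟨v, hv, hv', T, (hd2 T hT).1, ?_, hsub⟩
        rw [pos2 F hx1, pos2 T (hd2 T hT).2]
        exact hltT

lemma rankShell_edgeless (h : ∀ u ∈ A, ∀ v ∈ A, ¬H.Adj u v) : RankShell H A := by
  have : ∀ F, IsMaxIndepIn H A F → F = A := fun F hF =>
    hF.2 A ⟨Finset.Subset.refl _, h⟩ hF.1.1
  refine ⟨fun _ => 0, fun F F' hF hF' _ => by rw [this F hF, this F' hF'], ?_⟩
  intro F F' _ _ hlt
  exact absurd hlt (lt_irrefl _)

lemma exists_link (x : V) (A : Finset V) (H : SimpleGraph V) : ∃ C, IsLink H A {x} C := by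
  classical
  refine ⟨A.filter fun v => v ≠ x ∧ ¬ H.Adj x v, fun v => ?_⟩
  simp

/-- A parametrization of a cycle by the integers. -/
structure CycPar (H : SimpleGraph V) (B : Finset V) (m : ℕ) (f : ℤ → V) : Prop where
  mem : ∀ a, f a ∈ B
  surj : ∀ v ∈ B, ∃ a : ℤ, 0 ≤ a ∧ a < m ∧ v = f a
  eq_iff : ∀ a b, f a = f b ↔ (m : ℤ) ∣ a - b
  adj_iff : ∀ a b, H.Adj (f a) (f b) ↔ (m : ℤ) ∣ a - b - 1 ∨ (m : ℤ) ∣ b - a - 1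

lemma dvd_small {m : ℕ} {d : ℤ} (h : (m : ℤ) ∣ d) (h1 : -(m : ℤ) < d) (h2 : d < m) : d = 0 := by
  apply Int.eq_zero_of_abs_lt_dvd h
  rw [abs_lt]; exact ⟨h1, h2⟩

lemma CycPar.shift {B : Finset V} {m : ℕ} {f : ℤ → V} (hf : CycPar H B m f)
    (hm : 3 ≤ m) (c : ℤ) : CycPar H B m (fun a => f (c + a)) := by
  refine ⟨fun a => hf.mem _, ?_, ?_, ?_⟩
  · intro v hv
    obtain ⟨a, _, _, rfl⟩ := hf.surj v hv
    refine ⟨(a - c) % m, Int.emod_nonneg _ (by omega), Int.emod_lt_of_pos _ (by omega), ?_⟩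
    rw [hf.eq_iff]
    have := Int.emod_add_mul_ediv (a - c) m
    exact ⟨(a - c) / m, by linarith⟩
  · intro a b; rw [hf.eq_iff]; ring_nf
  · intro a b; rw [hf.adj_iff]; ring_nf

lemma CycPar.refl {B : Finset V} {m : ℕ} {f : ℤ → V} (hf : CycPar H B m f)
    (hm : 3 ≤ m) (c : ℤ) : CycPar H B m (fun a => f (c - a)) := by
  refine ⟨fun a => hf.mem _, ?_, ?_, ?_⟩
  · intro v hv
    obtain ⟨a, _, _, rfl⟩ := hf.surj v hv
    refine ⟨(c - a) % m, Int.emod_nonneg _ (by omega), Int.emod_lt_of_pos _ (by omega), ?_⟩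
    rw [hf.eq_iff]
    have := Int.emod_add_mul_ediv (c - a) m
    exact ⟨-((c - a) / m), by linarith⟩
  · intro a b; rw [hf.eq_iff, ← Int.dvd_neg]; ring_nf
  · intro a b; rw [hf.adj_iff, or_comm]; ring_nf

lemma CycPar.exists_of_iso {B : Finset V} {m : ℕ} (hm : 3 ≤ m) (hc : IsCycleGraphOn H B m)
    {x : V} (hx : x ∈ B) : ∃ f, CycPar H B m f ∧ f 0 = x := by
  obtain ⟨_, ⟨e⟩⟩ := hc
  obtain ⟨k, rfl⟩ : ∃ k, m = k + 2 := ⟨m - 2, by omega⟩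
  let g : ℤ → Fin (k + 2) := fun a => ((a : ZMod (k + 2)) : Fin (k+2))
  let f : ℤ → V := fun a => (e.symm (g a)).1
  have hg : ∀ a b, g a = g b ↔ ((k + 2 : ℕ) : ℤ) ∣ a - b := by
    intro a b
    have := ZMod.intCast_eq_intCast_iff_dvd_sub b a (k + 2)
    rw [← this]; exact eq_comm
  have hgs : ∀ a b, g a - g b = 1 ↔ ((k + 2 : ℕ) : ℤ) ∣ a - b - 1 := by
    intro a b
    have h1 : g a - g b = g (a - b) := (Int.cast_sub (R := ZMod (k+2)) a b).symm
    have h2 : (1 : Fin (k+2)) = g 1 := (Int.cast_one (R := ZMod (k+2))).symm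
    rw [h1, h2, hg]
  have hf : CycPar H B (k + 2) f := by
    refine ⟨fun a => (e.symm (g a)).2, ?_, ?_, ?_⟩
    · intro v hv
      refine ⟨((e ⟨v, hv⟩).val : ℤ), by positivity, by exact_mod_cast (e ⟨v, hv⟩).2, ?_⟩
      have : g ((e ⟨v, hv⟩).val : ℤ) = e ⟨v, hv⟩ := by
        have h3 : (((e ⟨v, hv⟩).val : ℤ) : ZMod (k+2)) = (((e ⟨v, hv⟩).val : ℕ) : ZMod (k+2)) := by
          push_cast; rfl
        have h4 : (((e ⟨v, hv⟩).val : ℕ) : ZMod (k+2)) = (e ⟨v, hv⟩ : ZMod (k+2)) :=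
          ZMod.natCast_zmod_val (n := k+2) (e ⟨v, hv⟩)
        exact h3.trans h4
      simp only [f]
      rw [this]; simp
    · intro a b
      rw [← hg]
      simp only [f]
      rw [Subtype.val_inj, e.symm.injective.eq_iff]
    · intro a b
      have h1 : H.Adj (f a) (f b) ↔ (H.induce (B : Set V)).Adj (e.symm (g a)) (e.symm (g b)) := by
        simp [f]
      rw [h1, e.symm.map_adj_iff, SimpleGraph.cycleGraph_adj, hgs, hgs]
  obtain ⟨c, _, _, rfl⟩ := hf.surj x hx
  exact ⟨_, hf.shift hm c, by simp⟩

lemma even_not_shell {B : Finset V} {m : ℕ} {f : ℤ → V} (hf : CycPar H B m f) (hm : 3 ≤ m)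
    (hev : 2 ∣ m) : ¬ RankShell H B := by
  classical
  rintro ⟨pos, hinj, hsh⟩
  have hev' : (2 : ℤ) ∣ m := by exact_mod_cast hev
  let E : ℤ → Finset V := fun c => B.filter fun v => ∃ a, 2 ∣ a - c ∧ v = f a
  have hE : ∀ c a, f a ∈ E c ↔ 2 ∣ a - c := by
    intro c a
    simp only [E, Finset.mem_filter]
    constructor
    · rintro ⟨_, b, hb, hab⟩
      have := hev'.trans ((hf.eq_iff _ _).1 hab)
      omega
    · intro h; exact ⟨hf.mem _, a, h, rfl⟩
  have hEB : ∀ c, E c ⊆ B := fun c => Finset.filter_subset _ _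
  have hrep : ∀ c, ∀ v ∈ E c, ∃ a, v = f a ∧ 2 ∣ a - c := by
    intro c v hv
    obtain ⟨a, _, _, rfl⟩ := hf.surj v (hEB c hv)
    exact ⟨a, rfl, (hE c a).1 hv⟩
  have hmax : ∀ c, IsMaxIndepIn H B (E c) := by
    intro c
    refine maxIndep_of ⟨hEB c, ?_⟩ ?_
    · intro u hu v hv huv
      obtain ⟨a, rfl, ha⟩ := hrep c u hu
      obtain ⟨b, rfl, hb⟩ := hrep c v hv
      rw [hf.adj_iff] at huv
      rcases huv with h | h <;> have := hev'.trans h <;> omega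
    · intro v hv hvn
      obtain ⟨a, _, _, rfl⟩ := hf.surj v hv
      rw [hE] at hvn
      refine ⟨f (a + 1), (hE _ _).2 (by omega), (hf.adj_iff _ _).2 (Or.inl (by simp))⟩
  have key : ∀ c, ¬ pos (E (c + 1)) < pos (E c) := by
    intro c hlt
    obtain ⟨v, hv, -, F, hF, hltF, hsub⟩ := hsh _ _ (hmax c) (hmax (c + 1)) hlt
    have hFE : F ⊆ E c := by
      intro w hw
      obtain ⟨a, _, _, rfl⟩ := hf.surj w (hF.1.1 hw)
      by_contra hwn
      rw [hE] at hwn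
      have h1 : f (a + 1) ∈ E c := (hE _ _).2 (by omega)
      have h2 : f (a - 1) ∈ E c := (hE _ _).2 (by omega)
      have hne : f (a + 1) ≠ f (a - 1) := by
        rw [Ne, hf.eq_iff]
        intro h
        have := dvd_small h (by omega) (by omega)
        omega
      by_cases hv1 : f (a + 1) = v
      · have := hsub (Finset.mem_erase.2 ⟨fun h => hne (hv1.trans h.symm), h2⟩)
        exact hF.1.2 _ this _ hw ((hf.adj_iff _ _).2 (Or.inr (by simp)))
      · have := hsub (Finset.mem_erase.2 ⟨hv1, h1⟩)
        exact hF.1.2 _ this _ hw ((hf.adj_iff _ _).2 (Or.inl (by simp)))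
    rw [hF.2 _ (hmax c).1 hFE] at hltF
    exact lt_irrefl _ hltF
  have hE2 : E 2 = E 0 := by
    ext v
    simp only [E, Finset.mem_filter]
    refine and_congr_right fun _ => exists_congr fun a => and_congr_left fun _ => ?_
    omega
  have hne : E 0 ≠ E 1 := by
    intro h
    have h0 : f 0 ∈ E 0 := (hE _ _).2 (by omega)
    rw [h, hE] at h0
    omega
  have k0 := key 0
  have k1 := key 1
  norm_num [hE2] at k0 k1
  exact hne (hinj _ _ (hmax 0) (hmax 1) (by omega))

/-- The vertices `f 0, f 2, …, f (2k-2)`. -/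
def arc (k : ℕ) (f : ℤ → V) : Finset V := (Finset.range k).image fun i : ℕ => f (2 * (i : ℤ))

lemma mem_arc {k : ℕ} {f : ℤ → V} {v : V} : v ∈ arc k f ↔ ∃ i : ℤ, 0 ≤ i ∧ i < k ∧ v = f (2 * i) := by
  simp only [arc, Finset.mem_image, Finset.mem_range]
  constructor
  · rintro ⟨i, hi, rfl⟩; exact ⟨i, by omega, by omega, rfl⟩
  · rintro ⟨i, h0, hi, rfl⟩
    refine ⟨i.toNat, by omega, ?_⟩
    rw [Int.toNat_of_nonneg h0]

lemma CycPar.adj_small {B : Finset V} {m : ℕ} {f : ℤ → V} (hf : CycPar H B m f) {a b : ℤ}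
    (ha : 0 ≤ a) (ha' : a < m) (hb : 0 ≤ b) (hb' : b < m) (h : H.Adj (f a) (f b)) :
    a = b + 1 ∨ b = a + 1 ∨ (a = 0 ∧ b = m - 1) ∨ (b = 0 ∧ a = m - 1) := by
  rw [hf.adj_iff] at h
  rcases h with h | h
  · by_cases h' : a - b - 1 = -(m:ℤ)
    · omega
    · have := dvd_small h (by omega) (by omega)
      omega
  · by_cases h' : b - a - 1 = -(m:ℤ)
    · omega
    · have := dvd_small h (by omega) (by omega)
      omega

lemma arc_max {B : Finset V} {m k : ℕ} {f : ℤ → V} (hf : CycPar H B m f) (hk : 1 ≤ k)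
    (hm : m = 2 * k + 1) : IsMaxIndepIn H B (arc k f) := by
  refine maxIndep_of ⟨?_, ?_⟩ ?_
  · intro v hv
    obtain ⟨i, _, _, rfl⟩ := mem_arc.1 hv
    exact hf.mem _
  · intro u hu v hv huv
    obtain ⟨i, _, _, rfl⟩ := mem_arc.1 hu
    obtain ⟨j, _, _, rfl⟩ := mem_arc.1 hv
    have := hf.adj_small (by omega) (by omega) (by omega) (by omega) huv
    omega
  · intro v hv hvn
    obtain ⟨a, ha, ha', rfl⟩ := hf.surj v hv
    by_cases h : a = 2 * k
    · refine ⟨f (2 * 0), mem_arc.2 ⟨0, by omega, by omega, rfl⟩, (hf.adj_iff _ _).2 (Or.inl ?_)⟩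
      exact ⟨-1, by subst hm; push_cast; omega⟩
    · rcases Int.even_or_odd' a with ⟨i, rfl | rfl⟩
      · exact absurd (mem_arc.2 ⟨i, by omega, by omega, rfl⟩) hvn
      · exact ⟨f (2 * i), mem_arc.2 ⟨i, by omega, by omega, rfl⟩,
          (hf.adj_iff _ _).2 (Or.inr (by ring_nf; simp))⟩

lemma odd_key {B : Finset V} {m k : ℕ} {f : ℤ → V} (hf : CycPar H B m f) (hk : 3 ≤ k)
    (hm : m = 2 * k + 1) (pos : Finset V → ℕ)
    (hsh : ∀ F F', IsMaxIndepIn H B F → IsMaxIndepIn H B F' → pos F' < pos F →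
      ∃ v ∈ F, v ∉ F' ∧ ∃ F'', IsMaxIndepIn H B F'' ∧ pos F'' < pos F ∧ F.erase v ⊆ F'') 
    (h1 : pos (arc k fun a => f (-2 + a)) < pos (arc k fun a => f (2 + a)))
    (h2 : pos (arc k fun a => f (2 + a)) < pos (arc k f)) : False := by
  have hm3 : 3 ≤ m := by omega
  have hQ : IsMaxIndepIn H B (arc k fun a => f (2 + a)) := arc_max (hf.shift hm3 2) (by omega) hm
  have hP : IsMaxIndepIn H B (arc k fun a => f (-2 + a)) :=
    arc_max (hf.shift hm3 (-2)) (by omega) hm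
  have hL : IsMaxIndepIn H B (arc k f) := arc_max hf (by omega) hm
  obtain ⟨v, hv, hvP, F, hF, hlt, hsub⟩ := hsh _ _ hQ hP h1
  obtain ⟨j, hj0, hjk, rfl⟩ := mem_arc.1 hv
  have hj : k ≤ j + 2 := by
    by_contra hcon
    exact hvP (mem_arc.2 ⟨j + 2, by omega, by omega, by congr 1; ring⟩)
  have hin : ∀ i : ℤ, 1 ≤ i → i ≤ k → i ≠ j + 1 → f (2 * i) ∈ F := by
    intro i hi hik hij
    refine hsub (Finset.mem_erase.2 ⟨?_, mem_arc.2 ⟨i - 1, by omega, by omega, ?_⟩⟩)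
    · rw [Ne, hf.eq_iff]
      intro h
      have := dvd_small h (by omega) (by omega)
      omega
    · congr 1; ring
  have hadj : ∀ a b : ℤ, f a ∈ F → f b ∈ F → ¬ ((m : ℤ) ∣ a - b - 1) := by
    intro a b ha hb h
    exact hF.1.2 _ ha _ hb ((hf.adj_iff _ _).2 (Or.inl h))
  have heven : ∀ i : ℤ, 0 ≤ i → i < k → f (2 * i + 1) ∉ F := by
    intro i hi hik h
    by_cases hi1 : i = 0 ∨ i = j + 1
    · exact hadj _ _ (hin (i + 1) (by omega) (by omega) (by omega)) h (by ring_nf; simp)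
    · exact hadj _ _ h (hin i (by omega) (by omega) (by omega)) (by ring_nf; simp)
  have hQF : ∀ F', F' = F → ¬ (F' = (arc k fun a => f (2 + a)) ∨ F' = arc k f) := by
    rintro _ rfl (h | h) <;> rw [h] at hlt <;> omega
  apply hQF F rfl
  by_cases h0 : f 0 ∈ F
  · right
    have hn : f (2 * k) ∉ F := fun h => hadj _ _ h0 h ⟨-1, by subst hm; push_cast; omega⟩
    refine hF.2 _ hL.1 fun w hw => ?_
    obtain ⟨a, ha, ha', rfl⟩ := hf.surj w (hF.1.1 hw)
    rcases Int.even_or_odd' a with ⟨i, rfl | rfl⟩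
    · by_cases hik : i = k
      · subst hik; exact absurd hw hn
      · exact mem_arc.2 ⟨i, by omega, by omega, rfl⟩
    · exact absurd hw (heven i (by omega) (by omega))
  · left
    refine hF.2 _ hQ.1 fun w hw => ?_
    obtain ⟨a, ha, ha', rfl⟩ := hf.surj w (hF.1.1 hw)
    rcases Int.even_or_odd' a with ⟨i, rfl | rfl⟩
    · by_cases hik : i = 0
      · subst hik; exact absurd hw h0
      · exact mem_arc.2 ⟨i - 1, by omega, by omega, by congr 1; ring⟩
    · exact absurd hw (heven i (by omega) (by omega))

lemma arc_congr (k : ℕ) {g h : ℤ → V} (e : ∀ a, g a = h a) : arc k g = arc k h := by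
  rw [funext e]

lemma arc_reflect (k : ℕ) (f : ℤ → V) (c : ℤ) :
    arc k (fun a => f (c - a)) = arc k (fun a => f (c - 2 * k + 2 + a)) := by
  ext v
  rw [mem_arc, mem_arc]
  constructor
  · rintro ⟨i, h, h', rfl⟩
    exact ⟨k - 1 - i, by omega, by omega, by congr 1; ring⟩
  · rintro ⟨i, h, h', rfl⟩
    exact ⟨k - 1 - i, by omega, by omega, by congr 1; ring⟩

lemma odd_not_shell {B : Finset V} {m k : ℕ} {f : ℤ → V} (hf : CycPar H B m f) (hk : 3 ≤ k)
    (hm : m = 2 * k + 1) : ¬ RankShell H B := by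
  rintro ⟨pos, hinj, hsh⟩
  have hm3 : 3 ≤ m := by omega
  have hmx : ∀ c, IsMaxIndepIn H B (arc k fun a => f (c + a)) := fun c =>
    arc_max (hf.shift hm3 c) (by omega) hm
  obtain ⟨c, hc, hcmax⟩ := Finset.exists_max_image (Finset.range m)
    (fun c : ℕ => pos (arc k fun a => f (c + a))) ⟨0, by simp; omega⟩
  have hmax : ∀ d : ℤ, pos (arc k fun a => f (d + a)) ≤ pos (arc k fun a => f (c + a)) := by
    intro d
    have hr := hcmax (d % m).toNat (by
      have := Int.emod_lt_of_pos d (show (0:ℤ) < m by omega)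
      have := Int.emod_nonneg d (show (m:ℤ) ≠ 0 by omega)
      simp; omega)
    have h0 := Int.emod_nonneg d (show (m:ℤ) ≠ 0 by omega)
    rw [Int.toNat_of_nonneg h0] at hr
    rw [arc_congr k (g := fun a => f (d + a)) (h := fun a => f (d % m + a))]
    · exact hr
    · intro a
      rw [hf.eq_iff]
      have := Int.emod_add_mul_ediv d m
      exact ⟨d / m, by linarith⟩
  have hdist : ∀ d e : ℤ, d < e → e - d ≤ 4 → (e - d) % 2 = 0 → 
      pos (arc k fun a => f (d + a)) ≠ pos (arc k fun a => f (e + a)) := by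
    intro d e hde hde4 hpar he
    have h := hinj _ _ (hmx d) (hmx e) he
    have h1 : f d ∈ arc k fun a => f (d + a) := mem_arc.2 ⟨0, by omega, by omega, by simp⟩
    rw [h] at h1
    obtain ⟨i, hi, hik, h2⟩ := mem_arc.1 h1
    rw [hf.eq_iff] at h2
    obtain ⟨q, hq⟩ := h2
    have : q = -1 := by
      have : q < 0 := by
        by_contra hcon
        have : 0 ≤ (m:ℤ) * q := mul_nonneg (by omega) (by omega)
        omega
      have : -2 < q := by
        by_contra hcon
        have : (m:ℤ) * q ≤ m * (-2) := mul_le_mul_of_nonneg_left (by omega) (by omega)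
        omega
      omega
    subst this
    omega
  have e1 := hdist (c - 2) c (by omega) (by omega) (by omega)
  have e2 := hdist c (c + 2) (by omega) (by omega) (by omega)
  have e3 := hdist (c - 2) (c + 2) (by omega) (by omega) (by omega)
  have g1 := hmax (c - 2)
  have g2 := hmax (c + 2)
  rcases lt_or_gt_of_ne e3 with h | h
  · have b1 : (arc k fun a => f (c + (-2 + a))) = arc k fun a => f (c - 2 + a) :=
      arc_congr k fun a => by congr 1; ring
    have b2 : (arc k fun a => f (c + (2 + a))) = arc k fun a => f (c + 2 + a) :=
      arc_congr k fun a => by congr 1; ring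
    refine odd_key (hf.shift hm3 c) hk hm pos hsh ?_ ?_
    · rw [b1, b2]; exact h
    · rw [b2]; omega
  · have b1 : (arc k fun a => f (c + 2 * k - 2 - (-2 + a))) = arc k fun a => f (c + 2 + a) := by
      rw [arc_congr k (h := fun a => f (c + 2 * k - a)) fun a => by congr 1; ring, arc_reflect]
      exact arc_congr k fun a => by congr 1; ring
    have b2 : (arc k fun a => f (c + 2 * k - 2 - (2 + a))) = arc k fun a => f (c - 2 + a) := by
      rw [arc_congr k (h := fun a => f (c + 2 * k - 4 - a)) fun a => by congr 1; ring, arc_reflect]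
      exact arc_congr k fun a => by congr 1; ring
    have b3 : (arc k fun a => f (c + 2 * k - 2 - a)) = arc k fun a => f (c + a) := by
      rw [arc_reflect]
      exact arc_congr k fun a => by congr 1; ring
    refine odd_key (hf.refl hm3 (c + 2 * k - 2)) hk hm pos hsh ?_ ?_
    · rw [b1, b2]; exact h
    · rw [b2, b3]; omega

lemma cycle_not_shell {B : Finset V} {m : ℕ} {f : ℤ → V} (hf : CycPar H B m f) (hm : 3 ≤ m)
    (h : RankShell H B) : m = 3 ∨ m = 5 := by
  by_contra hcon
  by_cases hev : 2 ∣ m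
  · exact even_not_shell hf hm hev h
  · exact odd_not_shell (k := m / 2) hf (by omega) (by omega) h

/-- Abstract hypotheses on an attachment graph. -/
structure Attach {n : ℕ} (H : SimpleGraph V) (x : Fin n → V) (B : Fin n → Finset V)
    (m : Fin n → ℕ) (f : Fin n → ℤ → V) : Prop where
  hm : ∀ i, 3 ≤ m i
  disj : ∀ i j, i ≠ j → Disjoint (B i) (B j)
  par : ∀ i, CycPar H (B i) (m i) (f i)
  f0 : ∀ i, f i 0 = x i
  cross : ∀ i j u v, i ≠ j → u ∈ B i → v ∈ B j → H.Adj u v → u = x i ∧ v = x j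

lemma Attach.forward {n : ℕ} {x : Fin n → V} {B : Fin n → Finset V}
    {m : Fin n → ℕ} {f : Fin n → ℤ → V} (h : Attach H x B m f)
    (hs : RankShell H (Finset.univ.biUnion B)) (i : Fin n) : m i = 3 ∨ m i = 5 := by
  classical
  refine cycle_not_shell (h.par i) (h.hm i) ?_
  have hf1 : ∀ j, f j 1 ≠ x j := by
    intro j hj
    rw [← h.f0, (h.par j).eq_iff] at hj
    have := h.hm j
    have := dvd_small hj (by omega) (by omega)
    omega
  have hidx : ∀ j l v, v ∈ B j → v ∈ B l → j = l := by
    intro j l v hj hl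
    by_contra hne
    exact Finset.disjoint_left.1 (h.disj j l hne) hj hl
  let D : Finset V := (Finset.univ.erase i).biUnion fun j => (B j).erase (x j)
  have hD : ∀ v, v ∈ D ↔ ∃ j, j ≠ i ∧ v ≠ x j ∧ v ∈ B j := by
    intro v; simp [D]
  let T : Finset V := (Finset.univ.erase i).image fun j => f j 1
  have hT : IsIndepIn H D T := by
    constructor
    · intro v hv
      simp only [T, Finset.mem_image, Finset.mem_erase, Finset.mem_univ, and_true] at hv
      obtain ⟨j, hj, rfl⟩ := hv
      exact (hD _).2 ⟨j, hj, hf1 j, (h.par j).mem _⟩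
    · intro u hu v hv huv
      simp only [T, Finset.mem_image, Finset.mem_erase, Finset.mem_univ, and_true] at hu hv
      obtain ⟨j, hj, rfl⟩ := hu
      obtain ⟨l, hl, rfl⟩ := hv
      by_cases hjl : j = l
      · subst hjl; exact H.loopless.irrefl _ huv
      · exact hf1 j (h.cross j l _ _ hjl ((h.par j).mem _) ((h.par l).mem _) huv).1
  obtain ⟨R, hTR, hR⟩ := exists_maxIndep hT
  have hRA : IsIndepIn H (Finset.univ.biUnion B) R := by
    refine ⟨fun v hv => ?_, hR.1.2⟩
    obtain ⟨j, _, _, hj⟩ := (hD v).1 (hR.1.1 hv)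
    simp only [Finset.mem_biUnion, Finset.mem_univ, true_and]
    exact ⟨j, hj⟩
  refine rankShell_link hRA ?_ hs
  intro v
  constructor
  · intro hv
    refine ⟨by simp only [Finset.mem_biUnion, Finset.mem_univ, true_and]; exact ⟨i, hv⟩, ?_, ?_⟩
    · intro hvR
      obtain ⟨j, hj, _, hvj⟩ := (hD v).1 (hR.1.1 hvR)
      exact hj (hidx _ _ _ hvj hv)
    · intro u hu huv
      obtain ⟨j, hj, hux, huj⟩ := (hD u).1 (hR.1.1 hu)
      exact hux (h.cross j i _ _ hj huj hv huv).1
  · rintro ⟨hv, hvR, hvn⟩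
    simp only [Finset.mem_biUnion, Finset.mem_univ, true_and] at hv
    obtain ⟨j, hj⟩ := hv
    by_cases hji : j = i
    · exact hji ▸ hj
    · exfalso
      by_cases hvx : v = x j
      · subst hvx
        refine hvn (f j 1) (hTR (Finset.mem_image.2 ⟨j, by simp [hji], rfl⟩)) ?_
        rw [← h.f0, (h.par j).adj_iff]
        left; simp
      · obtain ⟨u, hu, huv⟩ := maxIndep_iff_aux hR v ((hD v).2 ⟨j, hji, hvx, hj⟩) hvR
        exact hvn u hu huv

lemma Attach.backward {n : ℕ} {x : Fin n → V} {B : Fin n → Finset V}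
    {m : Fin n → ℕ} {f : Fin n → ℤ → V} (h : Attach H x B m f)
    (h35 : ∀ i, m i = 3 ∨ m i = 5) (N : ℕ) : ∀ A : Finset V, A.card = N →
    A ⊆ Finset.univ.biUnion B → (∀ i, x i ∈ A → B i ⊆ A) → RankShell H A := by
  induction N using Nat.strong_induction_on with
  | _ N ih =>
  intro A hN hAB hI
  have hAB' : ∀ v ∈ A, ∃ i, v ∈ B i := fun v hv => by simpa using hAB hv
  have hxB : ∀ i, x i ∈ B i := fun i => h.f0 i ▸ (h.par i).mem 0
  have hidx : ∀ j l v, v ∈ B j → v ∈ B l → j = l := by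
    intro j l v hj hl
    by_contra hne
    exact Finset.disjoint_left.1 (h.disj j l hne) hj hl
  -- edges at a vertex other than the attaching vertex
  have hloc : ∀ i u v, u ∈ B i → u ≠ x i → v ∈ A → H.Adj u v → v ∈ B i := by
    intro i u v hu hux hv huv
    obtain ⟨j, hj⟩ := hAB' v hv
    by_cases hij : i = j
    · exact hij ▸ hj
    · exact absurd (h.cross i j u v hij hu hj huv).1 hux
  have step : ∀ y ∈ A, ∀ C, IsLink H A {y} C → C.card < N := by
    intro y hy C hC
    rw [← hN]
    refine Finset.card_lt_card ⟨fun v hv => ((hC v).1 hv).1, fun hs => ?_⟩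
    exact ((hC y).1 (hs hy)).2.1 (by simp)
  have step2 : ∀ y ∈ A, (A.erase y).card < N := by
    intro y hy
    rw [← hN]; exact Finset.card_erase_lt_of_mem hy
  by_cases hxA : ∃ i, x i ∈ A
  · obtain ⟨i, hi⟩ := hxA
    obtain ⟨C, hC⟩ := exists_link (x i) A H
    have hCA : C ⊆ A := fun v hv => ((hC v).1 hv).1
    refine rankShell_shed hi hC (ih _ (step _ hi C hC) C rfl (hCA.trans hAB) ?_)
      (ih _ (step2 _ hi) _ rfl ((Finset.erase_subset _ _).trans hAB) ?_) ?_
    · intro j hj v hv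
      have hj' := (hC _).1 hj
      simp only [Finset.mem_singleton, forall_eq] at hj'
      have hij : i ≠ j := by rintro rfl; exact hj'.2.1 rfl
      refine (hC v).2 ⟨hI j hj'.1 hv, ?_⟩
      simp only [Finset.mem_singleton, forall_eq]
      refine ⟨?_, ?_⟩
      · rintro rfl; exact hij (hidx _ _ _ (hxB i) hv)
      · intro hadj
        have := (h.cross i j _ _ hij (hxB i) hv hadj).2
        subst this
        exact hj'.2.2 hadj
    · intro j hj v hv
      have hj' := Finset.mem_erase.1 hj
      refine Finset.mem_erase.2 ⟨?_, hI j hj'.2 hv⟩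
      rintro rfl
      have := hidx _ _ _ (hxB i) hv
      subst this
      exact hj'.1 rfl
    · intro S hS
      have hBA := hI i hi
      have par := h.par i
      have hSA : S ⊆ A := hS.1.trans hCA
      have hSx : ∀ u ∈ S, ¬ H.Adj (x i) u ∧ u ≠ x i := by
        intro u hu
        have := (hC u).1 (hS.1 hu)
        simp only [Finset.mem_singleton, forall_eq] at this
        exact ⟨this.2.2, this.2.1⟩
      have hfS : ∀ a, f i a ∈ S → ¬ ((m i : ℤ) ∣ 0 - a - 1 ∨ (m i : ℤ) ∣ a - 0 - 1) ∧
          ¬ (m i : ℤ) ∣ a - 0 := by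
        intro a ha
        have := hSx _ ha
        rw [← h.f0, par.adj_iff, Ne, par.eq_iff] at this
        exact this
      have hx1 : ∀ a, f i a = x i ↔ (m i : ℤ) ∣ a - 0 := by
        intro a; rw [← h.f0, par.eq_iff]
      by_cases h2 : f i 2 ∈ S
      · refine ⟨f i (-1), hBA (par.mem _), ?_, ?_⟩
        · rw [← h.f0, par.adj_iff]; left; simp
        · intro u hu hadj
          have hne : f i (-1) ≠ x i := by
            rw [Ne, hx1]
            rcases h35 i with h3 | h3 <;> rw [h3] <;> omega
          have huB := hloc i _ u (par.mem (-1)) hne (hSA hu) hadj.symm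
          obtain ⟨a, ha, ha', rfl⟩ := par.surj u huB
          have q1 := hfS _ hu
          have q2 := hfS _ h2
          have q3 := hS.2 _ h2 _ hu
          rw [par.adj_iff] at hadj q3
          rcases h35 i with h3 | h3 <;> rw [h3] at hadj q1 q2 q3 ha' <;> omega
      · refine ⟨f i 1, hBA (par.mem _), ?_, ?_⟩
        · rw [← h.f0, par.adj_iff]; right; simp
        · intro u hu hadj
          have hne : f i 1 ≠ x i := by
            rw [Ne, hx1]
            rcases h35 i with h3 | h3 <;> rw [h3] <;> omega
          have huB := hloc i _ u (par.mem 1) hne (hSA hu) hadj.symm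
          obtain ⟨a, ha, ha', rfl⟩ := par.surj u huB
          have q1 := hfS _ hu
          have q2 : f i a ≠ f i 2 := fun h => h2 (h ▸ hu)
          rw [Ne, par.eq_iff] at q2
          rw [par.adj_iff] at hadj
          rcases h35 i with h3 | h3 <;> rw [h3] at hadj q1 q2 ha' <;> omega
  · have hxA' : ∀ i, x i ∉ A := fun i hi => hxA ⟨i, hi⟩
    by_cases hedge : ∃ u ∈ A, ∃ v ∈ A, H.Adj u v
    · obtain ⟨u, hu, v, hv, huv⟩ := hedge
      obtain ⟨i, hui⟩ := hAB' u hu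
      have hvi := hloc i u v hui (fun h => hxA' i (h ▸ hu)) hv huv
      have par := h.par i
      have hmi := h.hm i
      -- an edge of consecutive vertices
      have hex : ∃ p : ℕ, f i p ∈ A ∧ f i (p + 1) ∈ A := by
        obtain ⟨a, ha, ha', rfl⟩ := par.surj u hui
        obtain ⟨b, hb, hb', rfl⟩ := par.surj v hvi
        have ha0 : a ≠ 0 := by rintro rfl; exact hxA' i (h.f0 i ▸ hu)
        have hb0 : b ≠ 0 := by rintro rfl; exact hxA' i (h.f0 i ▸ hv)
        rcases par.adj_small ha ha' hb hb' huv with hh | hh | hh | hh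
        · refine ⟨b.toNat, ?_, ?_⟩ <;> rw [Int.toNat_of_nonneg hb]
          · exact hv
          · exact hh ▸ hu
        · refine ⟨a.toNat, ?_, ?_⟩ <;> rw [Int.toNat_of_nonneg ha]
          · exact hu
          · exact hh ▸ hv
        · omega
        · omega
      classical
      obtain ⟨hp1, hp2⟩ := Nat.find_spec hex
      have hmin := fun q => Nat.find_min (m := q) hex
      generalize Nat.find hex = p at hp1 hp2 hmin
      have hp0 : p ≠ 0 := by
        rintro rfl
        exact hxA' i (h.f0 i ▸ hp1)
      have hpm : f i (p - 1) ∉ A := by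
        intro hq
        refine hmin (p - 1) (by omega) ⟨?_, ?_⟩
        · rw [Nat.cast_sub (by omega)]; exact_mod_cast hq
        · rw [Nat.cast_sub (by omega)]; simpa using hp1
      obtain ⟨C, hC⟩ := exists_link (f i (p + 1)) A H
      have hCA : C ⊆ A := fun v hv => ((hC v).1 hv).1
      refine rankShell_shed hp2 hC (ih _ (step _ hp2 C hC) C rfl (hCA.trans hAB) ?_)
        (ih _ (step2 _ hp2) _ rfl ((Finset.erase_subset _ _).trans hAB) ?_) ?_
      · intro j hj; exact absurd (hCA hj) (hxA' j)
      · intro j hj; exact absurd (Finset.mem_of_mem_erase hj) (hxA' j)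
      · intro S hS
        refine ⟨f i p, hp1, (par.adj_iff _ _).2 (Or.inl (by simp)), ?_⟩
        intro w hw hadj
        have hwC := (hC w).1 (hS.1 hw)
        have hwB := hloc i _ w (par.mem p) (fun h => hxA' i (h ▸ hp1)) hwC.1 hadj.symm
        obtain ⟨a, -, -, rfl⟩ := par.surj w hwB
        rw [par.adj_iff] at hadj
        rcases hadj with hd | hd
        · refine hwC.2.1 (Finset.mem_singleton.2 ((par.eq_iff _ _).2 ?_))
          convert hd using 1; ring
        · apply hpm
          have : f i (p - 1) = f i a := by
            rw [par.eq_iff]; convert hd using 1; ring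
          rw [this]; exact hwC.1
    · push Not at hedge
      exact rankShell_edgeless hedge

end Helpers

/-- The graph obtained by attaching a cycle of length `m i ≥ 3` to each
vertex of `G` is shellable iff every `m i` is `3` or `5`. -/
theorem stmt_7 {V : Type*} [DecidableEq V] (n : ℕ) (x : Fin n → V) (B : Fin n → Finset V)
    (G : SimpleGraph V) (Gs : Fin n → SimpleGraph V) (m : Fin n → ℕ)
    (hxinj : Function.Injective x)
    (hGsupp : ∀ u v, G.Adj u v → (∃ i, u = x i) ∧ (∃ j, v = x j))
    (hxB : ∀ i, x i ∈ B i)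
    (hBdisj : ∀ i j, i ≠ j → Disjoint (B i) (B j))
    (hm : ∀ i, 3 ≤ m i)
    (hcyc : ∀ i, IsCycleGraphOn (Gs i) (B i) (m i)) :
    ShellableOn (G ⊔ ⨆ i, Gs i) (Finset.univ.biUnion B) ↔
      ∀ i, m i = 3 ∨ m i = 5 := by
  classical
  have hidx : ∀ j l v, v ∈ B j → v ∈ B l → j = l := by
    intro j l v hj hl
    by_contra hne
    exact Finset.disjoint_left.1 (hBdisj j l hne) hj hl
  have hex := fun i => CycPar.exists_of_iso (hm i) (hcyc i) (hxB i)
  choose f hf hf0 using hex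
  have hadj : ∀ u v, (G ⊔ ⨆ i, Gs i).Adj u v ↔ G.Adj u v ∨ ∃ i, (Gs i).Adj u v := by
    intro u v; simp
  have hatt : Attach (G ⊔ ⨆ i, Gs i) x B m f := by
    refine ⟨hm, hBdisj, ?_, hf0, ?_⟩
    · intro i
      refine ⟨(hf i).mem, (hf i).surj, (hf i).eq_iff, ?_⟩
      intro a b
      rw [← (hf i).adj_iff, hadj]
      constructor
      · rintro (hG | ⟨j, hj⟩)
        · obtain ⟨⟨c, hc⟩, ⟨d, hd⟩⟩ := hGsupp _ _ hG
          have h1 := hidx c i (x c) (hxB c) (hc ▸ (hf i).mem a)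
          have h2 := hidx d i (x d) (hxB d) (hd ▸ (hf i).mem b)
          rw [hc, hd, h1, h2] at hG
          exact absurd hG (G.loopless.irrefl _)
        · have h1 := hidx j i _ ((hcyc j).1 _ _ hj).1 ((hf i).mem a)
          exact h1 ▸ hj
      · intro h; exact Or.inr ⟨i, h⟩
    · intro i j u v hij hu hv huv
      rw [hadj] at huv
      rcases huv with hG | ⟨l, hl⟩
      · obtain ⟨⟨c, hc⟩, ⟨d, hd⟩⟩ := hGsupp _ _ hG
        subst hc hd
        rw [hidx c i (x c) (hxB c) hu, hidx d j (x d) (hxB d) hv]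
        exact ⟨rfl, rfl⟩
      · have h1 := (hcyc l).1 _ _ hl
        exact absurd ((hidx _ _ _ hu h1.1).trans (hidx _ _ _ hv h1.2).symm) hij
  constructor
  · intro h i
    exact hatt.forward (rankShell_of_shellable h) i
  · intro h35
    apply shellable_of_rankShell
    refine hatt.backward h35 _ _ rfl (Finset.Subset.refl _) ?_
    intro i _
    exact Finset.subset_biUnion_of_mem B (Finset.mem_univ i)
end

section
/- Let G be a finite simple graph on vertex set {x_{11}, …, x_{n1}} with no isolated vertex. Let C_1, …, C_m (0 ≤ m ≤ n) be cycle graphs with x_{i1} ∈ V(C_i), and let G_{m+1}, …, G_n be connected chordal graphs with at least two vertices such that x_{i1} is a neighbor of a simplicial vertex of G_i for each i = m+1, …, n. Set G' = G(C_1, …, C_m, G_{m+1}, …, G_n). If G' is unmixed, then G' is vertex decomposable. -/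
variable {V : Type*} [DecidableEq V]

section helpers
open SimpleGraph

/-- restriction of a graph to a set of vertices (kept on the same type) -/
def restr {V : Type*} (G : SimpleGraph V) (P : V → Prop) : SimpleGraph V where
  Adj a b := G.Adj a b ∧ P a ∧ P b
  symm := ⟨fun _ _ h => ⟨h.1.symm, h.2.2, h.2.1⟩⟩
  loopless := ⟨fun a h => G.loopless.irrefl a h.1⟩

lemma shortest_aux {V : Type*} {G : SimpleGraph V} {u v : V} (p : G.Walk u v)
    (hp : p.length = G.dist u v) {i j : ℕ} (hij : i < j) (hj : j ≤ p.length)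
    (h : G.Adj (p.getVert i) (p.getVert j)) : s(p.getVert i, p.getVert j) ∈ p.edges := by
  have h1 := SimpleGraph.dist_le ((p.take i).append (Walk.cons h (p.drop j)))
  simp only [Walk.length_append, Walk.length_cons, Walk.take_length, Walk.drop_length] at h1
  have : j = i + 1 := by omega
  subst this
  have := p.toSubgraph_adj_getVert (i := i) (by omega)
  exact (Walk.adj_toSubgraph_iff_mem_edges).1 this

lemma shortest_chordless {V : Type*} {G : SimpleGraph V} {u v : V} (p : G.Walk u v)
    (hp : p.length = G.dist u v) {a b : V} (ha : a ∈ p.support) (hb : b ∈ p.support)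
    (h : G.Adj a b) : s(a, b) ∈ p.edges := by
  obtain ⟨i, rfl, hi⟩ := Walk.mem_support_iff_exists_getVert.1 ha
  obtain ⟨j, rfl, hj⟩ := Walk.mem_support_iff_exists_getVert.1 hb
  rcases lt_trichotomy i j with hij | hij | hij
  · exact shortest_aux p hp hij hj h
  · subst hij; exact absurd h (G.loopless.irrefl _)
  · rw [Sym2.eq_swap]; exact shortest_aux p hp hij hi h.symm

/-- no two non-adjacent vertices `a`, `b` adjacent to `v` are joined by a path avoiding the
neighborhood of `v` -/
lemma chordal_sep {V : Type*} {G : SimpleGraph V} (hG : IsChordal G)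
    (P : V → Prop) (v a b : V) (hva : G.Adj v a) (hvb : G.Adj v b) (hab : a ≠ b)
    (hnab : ¬ G.Adj a b)
    (hP : ∀ w, P w → w = a ∨ w = b ∨ (w ≠ v ∧ ¬ G.Adj v w))
    (hPa : P a)
    (hr : (restr G P).Reachable a b) : False := by
  obtain ⟨p, hp⟩ := hr.exists_walk_length_eq_dist
  have hpath := p.isPath_of_length_eq_dist hp
  have hle : restr G P ≤ G := fun _ _ h => h.1
  have hsup : ∀ w ∈ p.support, P w := by
    intro w hw
    by_cases hwa : w = a
    · rwa [hwa]
    · obtain ⟨i, rfl, hi⟩ := Walk.mem_support_iff_exists_getVert.1 hw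
      cases i with
      | zero => simp at hwa
      | succ i => exact (p.adj_getVert_succ (i := i) (by omega)).2.2
  have hlen : 2 ≤ p.length := by
    by_contra hlt
    have : p.length = 0 ∨ p.length = 1 := by omega
    rcases this with h0 | h1
    · exact hab (Walk.eq_of_length_eq_zero h0)
    · exact hnab (Walk.adj_of_length_eq_one h1).1
  have hvs : v ∉ p.support := by
    intro hv
    rcases hP v (hsup v hv) with h | h | h
    · exact hva.ne h
    · exact hvb.ne h
    · exact h.1 rfl
  let q := p.mapLe hle
  have hqs : q.support = p.support := by simp [q]
  have hqe : q.edges = p.edges := by simp [q]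
  have hq : q.IsPath := by
    rw [Walk.isPath_def, hqs]; exact hpath.support_nodup
  have hc : (Walk.cons hva (q.concat hvb.symm)).IsCycle := by
    rw [Walk.cons_isCycle_iff]
    refine ⟨hq.concat (by rwa [hqs]) hvb.symm, ?_⟩
    rw [Walk.edges_concat, List.concat_eq_append, List.mem_append, not_or]
    refine ⟨fun h => ?_, ?_⟩
    · exact hvs (hqs ▸ Walk.fst_mem_support_of_mem_edges _ h)
    · simp only [List.mem_singleton, Sym2.eq_iff]
      rintro (⟨h, -⟩ | ⟨-, h⟩)
      · exact hvb.ne h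
      · exact hab h
  obtain ⟨u, w, hu, hw, huw, hne⟩ := hG v _ hc (by
    simp only [Walk.length_cons, Walk.length_concat]
    have : q.length = p.length := by simp [q]
    omega)
  simp only [Walk.support_cons, Walk.support_concat, List.concat_eq_append, List.mem_cons,
    List.mem_append, List.mem_singleton, hqs, List.not_mem_nil, or_false] at hu hw
  simp only [Walk.edges_cons, Walk.edges_concat, List.concat_eq_append, List.mem_cons,
    List.mem_append, List.mem_singleton, hqe, List.not_mem_nil, or_false, not_or] at hne
  have hu' : u = v ∨ u ∈ p.support := by tauto
  have hw' : w = v ∨ w ∈ p.support := by tauto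
  have key : ∀ w, w ∈ p.support → G.Adj v w → w = a ∨ w = b := by
    intro w hw h
    rcases hP w (hsup w hw) with h1 | h1 | h1
    · exact Or.inl h1
    · exact Or.inr h1
    · exact absurd h h1.2
  rcases hu' with rfl | hu'
  · rcases hw' with rfl | hw'
    · exact huw.ne rfl
    · rcases key w hw' huw with rfl | rfl
      · exact hne.1 rfl
      · exact hne.2.2 Sym2.eq_swap
  · rcases hw' with rfl | hw'
    · rcases key u hu' huw.symm with rfl | rfl
      · exact hne.1 Sym2.eq_swap
      · exact hne.2.2 rfl
    · exact hne.2.1 (shortest_chordless p hp hu' hw' ⟨huw, hsup u hu', hsup w hw'⟩)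

/-- `z` is simplicial in the induced subgraph on `A`. -/
def SimplIn {V : Type*} (G : SimpleGraph V) (A : Finset V) (z : V) : Prop :=
  z ∈ A ∧ ∀ u ∈ A, ∀ w ∈ A, G.Adj z u → G.Adj z w → u ≠ w → G.Adj u w

open scoped Classical in
/-- Dirac -/
lemma dirac_aux {V : Type*} {G : SimpleGraph V} (hG : IsChordal G) :
    ∀ (m : ℕ) (A : Finset V), A.card = m → ∀ v ∈ A, (∃ k ∈ A, k ≠ v ∧ ¬ G.Adj v k) →
      ∃ z, SimplIn G A z ∧ z ≠ v ∧ ¬ G.Adj v z := by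
  intro m
  induction m using Nat.strong_induction_on with
  | _ m ih =>
  rintro A rfl v hv ⟨k0, hk0A, hk0v, hk0⟩
  let R : V → Prop := fun w => w ∈ A ∧ w ≠ v ∧ ¬ G.Adj v w
  let K : V → Prop := fun w => (restr G R).Reachable k0 w
  have hk0R : R k0 := ⟨hk0A, hk0v, hk0⟩
  have hKk0 : K k0 := Reachable.refl _
  have hKR : ∀ w, K w → R w := by
    intro w hw
    have hw' := (reachable_iff_reflTransGen _ _).1 hw
    induction hw' with
    | refl => exact hk0R
    | tail _ h _ => exact h.2.2
  have hKstep : ∀ w s, K w → R s → G.Adj w s → K s := by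
    intro w s hw hs h
    exact Reachable.trans hw (Adj.reachable (show (restr G R).Adj w s from ⟨h, hKR w hw, hs⟩))
  let S : V → Prop := fun s => s ∈ A ∧ ¬ K s ∧ ∃ k, K k ∧ G.Adj s k
  have hSv : ∀ s, S s → G.Adj v s := by
    rintro s ⟨hsA, hsK, k, hk, hsk⟩
    by_contra hvs
    have hsv : s ≠ v := by
      rintro rfl
      exact (hKR k hk).2.2 hsk
    exact hsK (hKstep k s hk ⟨hsA, hsv, hvs⟩ hsk.symm)
  have hclique : ∀ a b, S a → S b → a ≠ b → G.Adj a b := by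
    intro a b ha hb hab
    by_contra hnab
    refine chordal_sep hG (fun w => w = a ∨ w = b ∨ K w) v a b (hSv a ha) (hSv b hb) hab hnab
      ?_ (Or.inl rfl) ?_
    · rintro w (h | h | h)
      · exact Or.inl h
      · exact Or.inr (Or.inl h)
      · exact Or.inr (Or.inr (hKR w h).2)
    · have hreach : ∀ w, K w → (restr G (fun w => w = a ∨ w = b ∨ K w)).Reachable k0 w := by
        intro w hw
        have hw' := (reachable_iff_reflTransGen _ _).1 hw
        clear hw
        induction hw' with
        | refl => exact Reachable.refl _
        | @tail c d h1 h ih =>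
          have hc : K c := (reachable_iff_reflTransGen _ _).2 h1
          have hd : K d := hKstep c d hc h.2.2 h.1
          exact ih.trans (Adj.reachable ⟨h.1, Or.inr (Or.inr hc), Or.inr (Or.inr hd)⟩)
      obtain ⟨_, _, k, hk, hak⟩ := ha
      obtain ⟨_, _, k', hk', hbk⟩ := hb
      have e1 : (restr G (fun w => w = a ∨ w = b ∨ K w)).Reachable a k :=
        Adj.reachable ⟨hak, Or.inl rfl, Or.inr (Or.inr hk)⟩
      have e2 : (restr G (fun w => w = a ∨ w = b ∨ K w)).Reachable b k' :=
        Adj.reachable ⟨hbk, Or.inr (Or.inl rfl), Or.inr (Or.inr hk')⟩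
      exact e1.trans ((hreach k hk).symm.trans ((hreach k' hk').trans e2.symm))
  let A' : Finset V := A.filter (fun w => K w ∨ S w)
  have hA' : ∀ w, w ∈ A' ↔ (K w ∨ S w) := by
    intro w
    simp only [A', Finset.mem_filter, and_iff_right_iff_imp]
    rintro (h | h)
    · exact (hKR w h).1
    · exact h.1
  have hvA' : v ∉ A' := by
    rw [hA']
    rintro (h | h)
    · exact (hKR v h).2.1 rfl
    · exact (hSv v h).ne rfl
  have hcard : A'.card < A.card :=
    Finset.card_lt_card ⟨Finset.filter_subset _ _, fun h => hvA' (h hv)⟩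
  have hnb : ∀ k u, K k → u ∈ A → G.Adj k u → u ∈ A' := by
    intro k u hk hu hku
    rw [hA']
    by_cases h : K u
    · exact Or.inl h
    · exact Or.inr ⟨hu, h, k, hk, hku.symm⟩
  have lift : ∀ z, K z → SimplIn G A' z → ∃ z, SimplIn G A z ∧ z ≠ v ∧ ¬ G.Adj v z := by
    intro z hz hs
    refine ⟨z, ⟨(hKR z hz).1, ?_⟩, (hKR z hz).2⟩
    intro u hu w hw h1 h2
    exact hs.2 u (hnb z u hz hu h1) w (hnb z w hz hw h2) h1 h2
  by_cases h1 : ∃ s, S s ∧ ∃ k ∈ A', k ≠ s ∧ ¬ G.Adj s k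
  · obtain ⟨s, hs, hk⟩ := h1
    obtain ⟨z, hz, hzs, hzn⟩ := ih _ hcard A' rfl s ((hA' s).2 (Or.inr hs)) hk
    rcases (hA' z).1 hz.1 with h | h
    · exact lift z h hz
    · exact absurd (hclique s z hs h hzs.symm) hzn
  · push Not at h1
    by_cases h2 : ∃ k, K k ∧ ∃ k' ∈ A', k' ≠ k ∧ ¬ G.Adj k k'
    · obtain ⟨k, hk, hk'⟩ := h2
      obtain ⟨z, hz, hzs, hzn⟩ := ih _ hcard A' rfl k ((hA' k).2 (Or.inl hk)) hk'
      rcases (hA' z).1 hz.1 with h | h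
      · exact lift z h hz
      · exact absurd (h1 z h k ((hA' k).2 (Or.inl hk)) hzs.symm).symm hzn
    · push Not at h2
      refine lift k0 hKk0 ⟨(hA' k0).2 (Or.inl hKk0), ?_⟩
      intro u hu w hw _ _ huw
      rcases (hA' u).1 hu with h | h
      · exact h2 u h w hw huw.symm
      · exact h1 u h w hw huw.symm

lemma dirac {V : Type*} {G : SimpleGraph V} (hG : IsChordal G) (A : Finset V)
    (hA : A.Nonempty) : ∃ z, SimplIn G A z := by
  obtain ⟨v, hv⟩ := hA
  by_cases h : ∃ v ∈ A, ∃ k ∈ A, k ≠ v ∧ ¬ G.Adj v k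
  · obtain ⟨v, hv, h⟩ := h
    obtain ⟨z, hz, _⟩ := dirac_aux hG _ A rfl v hv h
    exact ⟨z, hz⟩
  · push Not at h
    exact ⟨v, hv, fun u hu w hw _ _ huw => h u hu w hw huw.symm⟩

/-- the exchange condition from a single neighbor -/
lemma exch_insert {V : Type*} [DecidableEq V] {G : SimpleGraph V} {A S : Finset V} {z x : V}
    (hS : IsIndepIn G (delClosedNbhd G A x) S) (hzA : z ∈ A) (hzx : G.Adj z x)
    (hzS : ∀ u ∈ S, ¬ G.Adj z u) :
      ∃ y ∈ A, G.Adj x y ∧ IsIndepIn G (A.erase x) (insert y S) := by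
  classical
  have hS' : ∀ u ∈ S, u ∈ A ∧ u ≠ x ∧ ¬ G.Adj x u := by
    intro u hu
    simpa [delClosedNbhd] using hS.1 hu
  refine ⟨z, hzA, hzx.symm, ?_, ?_⟩
  · intro u hu
    rcases Finset.mem_insert.1 hu with rfl | hu
    · exact Finset.mem_erase.2 ⟨hzx.ne, hzA⟩
    · exact Finset.mem_erase.2 ⟨(hS' u hu).2.1, (hS' u hu).1⟩
  · intro u hu w hw h
    rcases Finset.mem_insert.1 hu with rfl | hu'
    · rcases Finset.mem_insert.1 hw with rfl | hw'
      · exact h.ne rfl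
      · exact hzS w hw' h
    · rcases Finset.mem_insert.1 hw with rfl | hw'
      · exact hzS u hu' h.symm
      · exact hS.2 u hu' w hw' h

/-- a neighbor of a simplicial vertex satisfies the exchange condition -/
lemma exch_of_simpl {V : Type*} [DecidableEq V] {G : SimpleGraph V} {A : Finset V} {z x : V}
    (hzA : z ∈ A) (hzx : G.Adj z x)
    (hz : ∀ u ∈ A, G.Adj z u → u ≠ x → G.Adj x u) :
    ∀ S, IsIndepIn G (delClosedNbhd G A x) S →
      ∃ y ∈ A, G.Adj x y ∧ IsIndepIn G (A.erase x) (insert y S) := by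
  classical
  intro S hS
  have hS' : ∀ u ∈ S, u ∈ A ∧ u ≠ x ∧ ¬ G.Adj x u := by
    intro u hu
    simpa [delClosedNbhd] using hS.1 hu
  exact exch_insert hS hzA hzx fun u hu h =>
    (hS' u hu).2.2 (hz u (hS' u hu).1 h (hS' u hu).2.1)

lemma delClosedNbhd_card_lt {V : Type*} [DecidableEq V] {G : SimpleGraph V} {A : Finset V} {x : V}
    (hx : x ∈ A) : (delClosedNbhd G A x).card < A.card := by
  classical
  refine Finset.card_lt_card ⟨Finset.filter_subset _ _, fun h => ?_⟩
  have := h hx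
  simp [delClosedNbhd] at this

lemma delClosedNbhd_subset {V : Type*} [DecidableEq V] {G : SimpleGraph V} {A : Finset V} {x : V} :
    delClosedNbhd G A x ⊆ A := by
  classical
  exact Finset.filter_subset _ _

/-- graphs all of whose induced subgraphs have simplicial vertices are vertex decomposable -/
lemma vd_of_simpl {V : Type*} [DecidableEq V] {G : SimpleGraph V} :
    ∀ (m : ℕ) (A : Finset V), A.card = m →
      (∀ A' ⊆ A, A'.Nonempty → ∃ z, SimplIn G A' z) → VertexDecomposableOn G A := by
  classical
  intro m
  induction m using Nat.strong_induction_on with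
  | _ m ih =>
  rintro A rfl hA
  by_cases hE : ∀ u ∈ A, ∀ v ∈ A, ¬ G.Adj u v
  · exact .edgeless A hE
  push Not at hE
  obtain ⟨u, hu, v, hv, huv⟩ := hE
  obtain ⟨z, hz, hzs⟩ := hA (A.filter fun w => ∃ y ∈ A, G.Adj w y) (Finset.filter_subset _ _)
    ⟨u, Finset.mem_filter.2 ⟨hu, v, hv, huv⟩⟩
  obtain ⟨hzA, x, hx, hzx⟩ := Finset.mem_filter.1 hz
  refine .shed A x hx ?_ ?_ (exch_of_simpl hzA hzx ?_)
  · exact ih _ (delClosedNbhd_card_lt hx) _ rfl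
      fun A' hA' => hA A' (hA'.trans delClosedNbhd_subset)
  · exact ih _ (Finset.card_erase_lt_of_mem hx) _ rfl
      fun A' hA' => hA A' (hA'.trans (Finset.erase_subset _ _))
  · intro w hw hzw hwx
    exact hzs x (Finset.mem_filter.2 ⟨hx, z, hzA, hzx.symm⟩) w
      (Finset.mem_filter.2 ⟨hw, z, hzA, hzw.symm⟩) hzx hzw hwx.symm

/-- every independent set extends to a maximal one -/
lemma exists_max {V : Type*} [DecidableEq V] {G : SimpleGraph V} {A S : Finset V}
    (hS : IsIndepIn G A S) : ∃ W, IsMaxIndepIn G A W ∧ S ⊆ W := by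
  classical
  obtain ⟨W, hW, hmax⟩ := Finset.exists_max_image
    (A.powerset.filter fun W => IsIndepIn G A W ∧ S ⊆ W) Finset.card
    ⟨S, by simp [hS, hS.1]⟩
  simp only [Finset.mem_filter, Finset.mem_powerset] at hW hmax
  refine ⟨W, ⟨hW.2.1, fun T hT hWT => ?_⟩, hW.2.2⟩
  exact Finset.eq_of_subset_of_card_le hWT (hmax T ⟨hT.1, hT, hW.2.2.trans hWT⟩)

/-- a local obstruction to unmixedness -/
lemma not_unmixed {V : Type*} [DecidableEq V] {G : SimpleGraph V} {A S : Finset V} {a b c : V}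
    (hU : UnmixedOn G A) (ha : a ∈ A) (hc : c ∈ A)
    (hac : a ≠ c) (hnac : ¬ G.Adj a c) (hab : G.Adj b a) (hbc : G.Adj b c)
    (hb : ∀ u, G.Adj b u → u = a ∨ u = c)
    (hS : IsIndepIn G A (insert b S))
    (hda : ∀ u, G.Adj a u → u ≠ b → ∃ s ∈ S, G.Adj s u)
    (hdc : ∀ u, G.Adj c u → u ≠ b → ∃ s ∈ S, G.Adj s u) : False := by
  obtain ⟨W, hW, hSW⟩ := exists_max hS
  have hbW : b ∈ W := hSW (Finset.mem_insert_self _ _)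
  have hbA : b ∈ A := hW.1.1 hbW
  have haW : a ∉ W := fun h => hW.1.2 b hbW a h hab
  have hcW : c ∉ W := fun h => hW.1.2 b hbW c h hbc
  have hda' : ∀ u ∈ W, G.Adj a u → u = b := by
    intro u hu h
    by_contra hub
    obtain ⟨s, hs, hsu⟩ := hda u h hub
    exact hW.1.2 s (hSW (Finset.mem_insert_of_mem hs)) u hu hsu
  have hdc' : ∀ u ∈ W, G.Adj c u → u = b := by
    intro u hu h
    by_contra hub
    obtain ⟨s, hs, hsu⟩ := hdc u h hub
    exact hW.1.2 s (hSW (Finset.mem_insert_of_mem hs)) u hu hsu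
  let W' := insert a (insert c (W.erase b))
  have hW'mem : ∀ u, u ∈ W' ↔ u = a ∨ u = c ∨ (u ≠ b ∧ u ∈ W) := by
    intro u; simp [W']
  have hW' : IsIndepIn G A W' := by
    constructor
    · intro u hu
      rcases (hW'mem u).1 hu with rfl | rfl | h
      · exact ha
      · exact hc
      · exact hW.1.1 h.2
    · intro u hu w hw h
      rcases (hW'mem u).1 hu with rfl | rfl | hu1
      · rcases (hW'mem w).1 hw with rfl | rfl | hw
        · exact h.ne rfl
        · exact hnac h
        · exact hw.1 (hda' w hw.2 h)
      · rcases (hW'mem w).1 hw with rfl | rfl | hw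
        · exact hnac h.symm
        · exact h.ne rfl
        · exact hw.1 (hdc' w hw.2 h)
      · rcases (hW'mem w).1 hw with rfl | rfl | hw
        · exact hu1.1 (hda' u hu1.2 h.symm)
        · exact hu1.1 (hdc' u hu1.2 h.symm)
        · exact hW.1.2 u hu1.2 w hw.2 h
  have hmax : IsMaxIndepIn G A W' := by
    refine ⟨hW', fun T hT hWT => Finset.Subset.antisymm hWT ?_⟩
    intro u hu
    by_contra huW'
    have hTa : ∀ w ∈ W', ¬ G.Adj u w := fun w hw => hT.2 u hu w (hWT hw)
    have hub : u ≠ b := by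
      rintro rfl
      exact hTa a ((hW'mem a).2 (Or.inl rfl)) hab
    have hua : u ≠ a := fun h => huW' ((hW'mem u).2 (Or.inl h))
    have huc : u ≠ c := fun h => huW' ((hW'mem u).2 (Or.inr (Or.inl h)))
    have huW : u ∉ W := fun h => huW' ((hW'mem u).2 (Or.inr (Or.inr ⟨hub, h⟩)))
    have hub' : ¬ G.Adj b u := fun h => (hb u h).elim hua huc
    have hdW : ∀ w ∈ W, ¬ G.Adj u w := by
      intro w hw h
      by_cases hwb : w = b
      · subst hwb; exact hub' h.symm
      · exact hTa w ((hW'mem w).2 (Or.inr (Or.inr ⟨hwb, hw⟩))) h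
    have : W = insert u W := hW.2 _ ⟨by
      intro w hw
      rcases Finset.mem_insert.1 hw with rfl | hw
      · exact hT.1 hu
      · exact hW.1.1 hw, by
      intro w hw w' hw' h
      rcases Finset.mem_insert.1 hw with rfl | hw1
      · rcases Finset.mem_insert.1 hw' with rfl | hw2
        · exact h.ne rfl
        · exact hdW w' hw2 h
      · rcases Finset.mem_insert.1 hw' with rfl | hw2
        · exact hdW w hw1 h.symm
        · exact hW.1.2 w hw1 w' hw2 h⟩ (Finset.subset_insert _ _)
    exact huW (this ▸ Finset.mem_insert_self _ _)
  have h1 := hU _ _ hW hmax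
  have h2 : W'.card = W.card + 1 := by
    have e1 : (W.erase b).card + 1 = W.card := Finset.card_erase_add_one hbW
    have e2 : c ∉ W.erase b := fun h => hcW (Finset.mem_of_mem_erase h)
    have e3 : a ∉ insert c (W.erase b) := by
      simp only [Finset.mem_insert, not_or]
      exact ⟨hac, fun h => haW (Finset.mem_of_mem_erase h)⟩
    simp only [W', Finset.card_insert_of_notMem e3, Finset.card_insert_of_notMem e2]
    omega
  omega

/-- parametrisation of a cycle graph starting at a given vertex -/
lemma cycle_param {V : Type*} [DecidableEq V] {G : SimpleGraph V} {B : Finset V} {m : ℕ}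
    (h3 : 3 ≤ m) (h : IsCycleGraphOn G B m) {x : V} (hx : x ∈ B) :
    ∃ c : ZMod m → V, Function.Injective c ∧ c 0 = x ∧ (∀ u, u ∈ B ↔ ∃ k, c k = u) ∧
      (∀ k u, G.Adj (c k) u ↔ u = c (k + 1) ∨ u = c (k - 1)) := by
  obtain ⟨hsup, ⟨e⟩⟩ := h
  obtain ⟨m, rfl⟩ : ∃ m', m = m' + 2 := ⟨m - 2, by omega⟩
  let x' : (B : Set V) := ⟨x, hx⟩
  let c : ZMod (m + 2) → V := fun k => (e.symm (e x' + (show Fin (m+2) from k)) : (B : Set V)).1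
  have hinj : Function.Injective c := by
    intro k l hkl
    have h1 := e.symm.injective (Subtype.ext hkl)
    exact add_left_cancel (G := Fin (m + 2)) h1
  have hB : ∀ u, u ∈ B ↔ ∃ k, c k = u := by
    intro u
    constructor
    · intro hu
      refine ⟨(e ⟨u, hu⟩ - e x' : Fin (m+2)), ?_⟩
      simp [c]
    · rintro ⟨k, rfl⟩
      exact (e.symm (e x' + (show Fin (m+2) from k)) : (B : Set V)).2
  refine ⟨c, hinj, ?_, hB, ?_⟩
  · have : e x' + (show Fin (m+2) from (0 : ZMod (m+2))) = e x' := add_zero _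
    simp only [c, this]
    simp [x']
  · have hadj : ∀ k l, G.Adj (c k) (c l) ↔ k - l = 1 ∨ l - k = 1 := by
      intro k l
      have h1 : G.Adj (c k) (c l) ↔ (G.induce (B : Set V)).Adj
        (e.symm (e x' + (show Fin (m+2) from k))) (e.symm (e x' + (show Fin (m+2) from l))) := Iff.rfl
      rw [h1, e.symm.map_adj_iff, cycleGraph_adj, add_sub_add_left_eq_sub, add_sub_add_left_eq_sub]
      rfl
    intro k u
    constructor
    · intro h
      obtain ⟨l, rfl⟩ := (hB u).1 (hsup _ _ h).2
      rcases (hadj k l).1 h with h | h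
      · right; congr 1; rw [← h]; ring
      · left; congr 1; rw [← h]; ring
    · rintro (rfl | rfl)
      · rw [hadj]; right; ring
      · rw [hadj]; left; ring

/-- proper induced subgraphs of cycles have simplicial vertices -/
lemma cycle_simpl {V : Type*} {G : SimpleGraph V} {m : ℕ} (h3 : 3 ≤ m)
    (c : ZMod m → V)
    (hadj : ∀ k u, G.Adj (c k) u ↔ u = c (k + 1) ∨ u = c (k - 1))
    (A : Finset V) (hA : ∀ u ∈ A, ∃ k, c k = u) (h0 : c 0 ∉ A) (hne : A.Nonempty) :
    ∃ z, SimplIn G A z := by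
  have : NeZero m := ⟨by omega⟩
  have : ∃ k, c k ∈ A ∧ c (k - 1) ∉ A := by
    by_contra hcon
    push Not at hcon
    obtain ⟨u, hu⟩ := hne
    obtain ⟨k, rfl⟩ := hA u hu
    have h : ∀ j : ℕ, c (k - j) ∈ A := by
      intro j
      induction j with
      | zero => simpa using hu
      | succ j ih => have := hcon _ ih; rwa [Nat.cast_succ, ← sub_sub]
    apply h0
    have := h k.val
    simpa using this
  obtain ⟨k, hk, hk'⟩ := this
  refine ⟨c k, hk, ?_⟩
  have : ∀ u ∈ A, G.Adj (c k) u → u = c (k + 1) := by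
    intro u hu h
    rcases (hadj k u).1 h with h | h
    · exact h
    · exact absurd (h ▸ hu) hk'
  intro u hu w hw h1 h2 hne
  exact absurd ((this u hu h1).trans (this w hw h2).symm) hne

lemma zmod_ne {m a b : ℕ} (hab : a < b) (h : ¬ m ∣ b - a) : (a : ZMod m) ≠ (b : ZMod m) := by
  intro he
  exact h ((Nat.modEq_iff_dvd' hab.le).1 ((ZMod.natCast_eq_natCast_iff _ _ _).1 he))

/-- a cycle block satisfies the exchange property in an unmixed graph -/
lemma cycle_exch {V : Type*} [DecidableEq V] {H K : SimpleGraph V} {A0 B : Finset V} {m : ℕ}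
    (h3 : 3 ≤ m) (c : ZMod m → V) (hinj : Function.Injective c)
    (hB : ∀ u, u ∈ B ↔ ∃ k, c k = u)
    (hadj : ∀ k u, K.Adj (c k) u ↔ u = c (k + 1) ∨ u = c (k - 1))
    (hKH : ∀ u v, K.Adj u v → H.Adj u v)
    (hHK : ∀ u v, u ∈ B → u ≠ c 0 → H.Adj u v → K.Adj u v)
    (hBA : B ⊆ A0) (y : V) (hy : y ∉ B) (hyA : y ∈ A0) (hyx : H.Adj (c 0) y)
    (hU : UnmixedOn H A0) (A : Finset V) (hA : B ⊆ A) (S : Finset V)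
    (hS : IsIndepIn H (delClosedNbhd H A (c 0)) S) :
    ∃ y ∈ A, H.Adj (c 0) y ∧ IsIndepIn H (A.erase (c 0)) (insert y S) := by
  classical
  have hcB : ∀ k, c k ∈ B := fun k => (hB _).2 ⟨k, rfl⟩
  have hH : ∀ k u, k ≠ 0 → (H.Adj (c k) u ↔ u = c (k + 1) ∨ u = c (k - 1)) := by
    intro k u hk
    rw [← hadj]
    exact ⟨hHK _ _ (hcB k) (fun h => hk (hinj h)), hKH _ _⟩
  have hcS : ∀ u ∈ S, u ≠ c 0 := by
    intro u hu
    have := hS.1 hu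
    simp only [delClosedNbhd, Finset.mem_filter] at this
    exact this.2.1
  by_cases hm3 : m = 3
  · subst hm3
    refine exch_of_simpl (z := c 1) (hA (hcB 1)) ((hH 1 _ (by decide)).2 (Or.inr rfl)) ?_ S hS
    intro u hu h hne
    rcases (hH 1 u (by decide)).1 h with rfl | rfl
    · exact hKH _ _ ((hadj 0 _).2 (Or.inr (by congr 1)))
    · exact absurd rfl hne
  by_cases hm5 : m = 5
  · subst hm5
    by_cases h2 : c 2 ∈ S
    · have h3 : c 3 ∉ S := fun h =>
        hS.2 _ h2 _ h ((hH 2 _ (by decide)).2 (Or.inl (by congr 1)))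
      refine exch_insert (z := c 4) hS (hA (hcB 4)) ((hH 4 _ (by decide)).2 (Or.inl (by congr 1))) ?_
      intro u hu h
      rcases (hH 4 u (by decide)).1 h with rfl | rfl
      · exact hcS _ hu (by congr 1)
      · exact h3 hu
    · refine exch_insert (z := c 1) hS (hA (hcB 1)) ((hH 1 _ (by decide)).2 (Or.inr (by congr 1))) ?_
      intro u hu h
      rcases (hH 1 u (by decide)).1 h with rfl | rfl
      · exact h2 hu
      · exact hcS _ hu (by congr 1)
  exfalso
  have ndvd : ∀ d, 0 < d → d < m → ¬ m ∣ d := fun d h0 h h' =>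
    absurd (Nat.le_of_dvd h0 h') (by omega)
  have n1 : (1 : ZMod m) ≠ 0 := by
    have := zmod_ne (m := m) (a := 0) (b := 1) (by omega) (ndvd _ (by omega) (by omega))
    exact_mod_cast this.symm
  have n2 : (2 : ZMod m) ≠ 0 := by
    have := zmod_ne (m := m) (a := 0) (b := 2) (by omega) (ndvd _ (by omega) (by omega))
    exact_mod_cast this.symm
  have n3 : (3 : ZMod m) ≠ 0 := by
    have := zmod_ne (m := m) (a := 0) (b := 3) (by omega) (ndvd _ (by omega) (by omega))
    exact_mod_cast this.symm
  have hy2 : c 2 ≠ y := fun h => hy (h ▸ hcB 2)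
  have hya : ∀ k, k ≠ 0 → ¬ H.Adj (c k) y := by
    intro k hk h
    rcases (hH k y hk).1 h with h | h <;> exact hy (h ▸ hcB _)
  have hex : ∃ S0, IsIndepIn H A0 (insert (c 2) S0) ∧ (∃ s ∈ S0, H.Adj s (c 0)) ∧
      (∃ s ∈ S0, H.Adj s (c 4)) := by
    by_cases hm4 : m = 4
    · subst hm4
      refine ⟨{y}, ⟨?_, ?_⟩, ⟨y, by simp, hyx.symm⟩, ⟨y, by simp, hyx.symm⟩⟩
      · intro u hu
        simp only [Finset.mem_insert, Finset.mem_singleton] at hu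
        rcases hu with rfl | rfl
        · exact hBA (hcB 2)
        · exact hyA
      · intro u hu v hv h
        simp only [Finset.mem_insert, Finset.mem_singleton] at hu hv
        rcases hu with rfl | rfl <;> rcases hv with rfl | rfl
        · exact h.ne rfl
        · exact hya 2 n2 h
        · exact hya 2 n2 h.symm
        · exact h.ne rfl
    · have n5 : (5 : ZMod m) ≠ 0 := by
        have := zmod_ne (m := m) (a := 0) (b := 5) (by omega) (ndvd _ (by omega) (by omega))
        exact_mod_cast this.symm
      have n4 : (4 : ZMod m) ≠ 0 := by
        have := zmod_ne (m := m) (a := 0) (b := 4) (by omega) (ndvd _ (by omega) (by omega))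
        exact_mod_cast this.symm
      have h25 : ¬ H.Adj (c 2) (c 5) := by
        intro h
        rcases (hH 2 _ n2).1 h with h | h
        · exact n2 (by linear_combination hinj h)
        · exact n4 (by linear_combination hinj h)
      refine ⟨{y, c 5}, ⟨?_, ?_⟩, ⟨y, by simp, hyx.symm⟩, ⟨c 5, by simp, ?_⟩⟩
      · intro u hu
        simp only [Finset.mem_insert, Finset.mem_singleton] at hu
        rcases hu with rfl | rfl | rfl
        · exact hBA (hcB 2)
        · exact hyA
        · exact hBA (hcB 5)
      · intro u hu v hv h
        simp only [Finset.mem_insert, Finset.mem_singleton] at hu hv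
        rcases hu with rfl | rfl | rfl <;> rcases hv with rfl | rfl | rfl
        · exact h.ne rfl
        · exact hya 2 n2 h
        · exact h25 h
        · exact hya 2 n2 h.symm
        · exact h.ne rfl
        · exact hya 5 n5 h.symm
        · exact h25 h.symm
        · exact hya 5 n5 h
        · exact h.ne rfl
      · refine (hH 5 _ n5).2 (Or.inr ?_)
        congr 1; ring
  obtain ⟨S0, hS0, hd0, hd4⟩ := hex
  have e12 : (1 : ZMod m) + 1 = 2 := by ring
  have e10 : (1 : ZMod m) - 1 = 0 := by ring
  have e23 : (2 : ZMod m) + 1 = 3 := by ring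
  have e21 : (2 : ZMod m) - 1 = 1 := by ring
  have e34 : (3 : ZMod m) + 1 = 4 := by ring
  have e32 : (3 : ZMod m) - 1 = 2 := by ring
  have h1 := fun u => hH 1 u n1
  have h2 := fun u => hH 2 u n2
  have h3 := fun u => hH 3 u n3
  simp only [e12, e10] at h1
  simp only [e23, e21] at h2
  simp only [e34, e32] at h3
  refine not_unmixed hU (a := c 1) (b := c 2) (c := c 3) (hBA (hcB 1)) (hBA (hcB 3)) ?_ ?_
    ((h2 _).2 (Or.inr rfl)) ((h2 _).2 (Or.inl rfl)) ?_ hS0 ?_ ?_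
  · intro h; exact n2 (by linear_combination -hinj h)
  · intro h
    rcases (h1 _).1 h with h | h
    · exact n1 (by linear_combination hinj h)
    · exact n3 (hinj h)
  · intro u h; exact ((h2 u).1 h).symm
  · intro u h hne
    rcases (h1 u).1 h with rfl | rfl
    · exact absurd rfl hne
    · exact hd0
  · intro u h hne
    rcases (h3 u).1 h with rfl | rfl
    · exact hd4
    · exact absurd rfl hne

/-- induction shedding the attaching vertices one at a time -/
lemma vd_main {V : Type*} [DecidableEq V] {n : ℕ} (x : Fin n → V) (B : Fin n → Finset V)
    (H : SimpleGraph V)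
    (hnb : ∀ i j u, i ≠ j → u ∈ B j → u ≠ x j → ¬ H.Adj (x i) u)
    (hxB : ∀ i, x i ∈ B i) (hBdisj : ∀ i j, i ≠ j → Disjoint (B i) (B j))
    (hE : ∀ i A, B i ⊆ A → ∀ S, IsIndepIn H (delClosedNbhd H A (x i)) S →
      ∃ y ∈ A, H.Adj (x i) y ∧ IsIndepIn H (A.erase (x i)) (insert y S))
    (hbase : ∀ A ⊆ Finset.univ.biUnion B, (∀ i, x i ∉ A) → VertexDecomposableOn H A) :
    ∀ (m : ℕ) (A : Finset V), A.card = m → A ⊆ Finset.univ.biUnion B →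
      (∀ i, B i ⊆ A ∨ x i ∉ A) → VertexDecomposableOn H A := by
  classical
  intro m
  induction m using Nat.strong_induction_on with
  | _ m ih =>
  rintro A rfl hA hact
  by_cases h : ∀ i, x i ∉ A
  · exact hbase A hA h
  push Not at h
  obtain ⟨i, hi⟩ := h
  have hBi : B i ⊆ A := (hact i).resolve_right (fun h => h hi)
  refine .shed A (x i) hi ?_ ?_ (hE i A hBi)
  · refine ih _ (delClosedNbhd_card_lt hi) _ rfl (delClosedNbhd_subset.trans hA) fun j => ?_
    by_cases hj : x j ∈ delClosedNbhd H A (x i)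
    · left
      have hj' := hj
      simp only [delClosedNbhd, Finset.mem_filter] at hj'
      have hij : i ≠ j := by rintro rfl; exact hj'.2.1 rfl
      have hBj : B j ⊆ A := (hact j).resolve_right (fun h => h hj'.1)
      intro u hu
      by_cases hux : u = x j
      · rwa [hux]
      · simp only [delClosedNbhd, Finset.mem_filter]
        refine ⟨hBj hu, ?_, hnb i j u hij hu hux⟩
        rintro rfl
        exact Finset.disjoint_left.1 (hBdisj i j hij) (hxB i) hu
    · exact Or.inr hj
  · refine ih _ (Finset.card_erase_lt_of_mem hi) _ rfl ((Finset.erase_subset _ _).trans hA)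
      fun j => ?_
    by_cases hij : i = j
    · subst hij; right; simp
    rcases hact j with h | h
    · left
      intro u hu
      refine Finset.mem_erase.2 ⟨?_, h hu⟩
      rintro rfl
      exact Finset.disjoint_left.1 (hBdisj i j hij) (hxB i) hu
    · right
      exact fun h' => h (Finset.mem_of_mem_erase h')

end helpers

/-- if the attachment graph `G(C_1, …, C_t, G_{t+1}, …, G_n)` is unmixed,
then it is vertex decomposable. -/
theorem stmt_15 {V : Type*} [DecidableEq V] (n t : ℕ) (ht : t ≤ n) (x : Fin n → V)
    (B : Fin n → Finset V) (G : SimpleGraph V) (Gs : Fin n → SimpleGraph V)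
    (ℓ : Fin n → ℕ)
    (hxinj : Function.Injective x)
    (hGsupp : ∀ u v, G.Adj u v → (∃ i, u = x i) ∧ (∃ j, v = x j))
    -- `G` has no isolated vertex
    (hnoiso : ∀ i, ∃ u, G.Adj (x i) u)
    (hxB : ∀ i, x i ∈ B i)
    (hBdisj : ∀ i j, i ≠ j → Disjoint (B i) (B j))
    -- for `i < t`, `Gs i` is a cycle graph of length `ℓ i ≥ 3` on the vertex set `B i`
    (hcyc : ∀ i : Fin n, (i : ℕ) < t → 3 ≤ ℓ i ∧ IsCycleGraphOn (Gs i) (B i) (ℓ i))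
    -- for `i ≥ t`, `Gs i` is a connected chordal graph with at least two vertices,
    -- attached to `G` at a neighbor `x i` of a simplicial vertex `z` of `Gs i`
    (hBcard : ∀ i : Fin n, t ≤ (i : ℕ) → 2 ≤ (B i).card)
    (hGssupp : ∀ i : Fin n, t ≤ (i : ℕ) → ∀ u v, (Gs i).Adj u v → u ∈ B i ∧ v ∈ B i)
    (hconn : ∀ i : Fin n, t ≤ (i : ℕ) → ((Gs i).induce ((B i : Set V))).Connected)
    (hchordal : ∀ i : Fin n, t ≤ (i : ℕ) → IsChordal (Gs i))
    (hsimp : ∀ i : Fin n, t ≤ (i : ℕ) → ∃ z ∈ B i,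
      (∀ u v, (Gs i).Adj z u → (Gs i).Adj z v → u ≠ v → (Gs i).Adj u v) ∧
      (Gs i).Adj z (x i)) :
    UnmixedOn (G ⊔ ⨆ i, Gs i) (Finset.univ.biUnion B) →
      VertexDecomposableOn (G ⊔ ⨆ i, Gs i) (Finset.univ.biUnion B) := by
  intro hU
  have hH : ∀ u v, (G ⊔ ⨆ i, Gs i).Adj u v ↔ G.Adj u v ∨ ∃ i, (Gs i).Adj u v := by
    intro u v
    simp [SimpleGraph.sup_adj, SimpleGraph.iSup_adj]
  generalize (G ⊔ ⨆ i, Gs i) = H at hH hU ⊢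
  have hsupp : ∀ i u v, (Gs i).Adj u v → u ∈ B i ∧ v ∈ B i := by
    intro i u v h
    by_cases hi : (i : ℕ) < t
    · exact (hcyc i hi).2.1 u v h
    · exact hGssupp i (by omega) u v h
  have huniq : ∀ i j u, u ∈ B i → u ∈ B j → i = j := by
    intro i j u hi hj
    by_contra hij
    exact Finset.disjoint_left.1 (hBdisj i j hij) hi hj
  have hKH : ∀ i u v, (Gs i).Adj u v → H.Adj u v := fun i u v h => (hH u v).2 (Or.inr ⟨i, h⟩)
  have hHK : ∀ i u v, u ∈ B i → u ≠ x i → H.Adj u v → (Gs i).Adj u v := by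
    intro i u v hu hux h
    rcases (hH u v).1 h with h | ⟨j, h⟩
    · obtain ⟨j, rfl⟩ := (hGsupp u v h).1
      have := huniq i j _ hu (hxB j)
      subst this
      exact absurd rfl hux
    · have := huniq i j u hu (hsupp j u v h).1
      subst this
      exact h
  have hBA : ∀ i, B i ⊆ Finset.univ.biUnion B := fun i =>
    Finset.subset_biUnion_of_mem B (Finset.mem_univ i)
  refine vd_main x B H ?_ hxB hBdisj ?_ ?_ _ _ rfl (Finset.Subset.refl _) (fun i => Or.inl (hBA i))
  · intro i j u hij hu hux h
    have h' := hHK j u (x i) hu hux h.symm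
    exact hij (huniq i j (x i) (hxB i) (hsupp j _ _ h').2)
  · intro i A hA
    by_cases hi : (i : ℕ) < t
    · obtain ⟨h3, hc⟩ := hcyc i hi
      obtain ⟨c, hinj, h0, hB, hadj⟩ := cycle_param h3 hc (hxB i)
      obtain ⟨y, hy⟩ := hnoiso i
      obtain ⟨j, rfl⟩ := (hGsupp _ _ hy).2
      have hij : x j ∉ B i := by
        intro h
        have := huniq j i (x j) (hxB j) h
        subst this
        exact hy.ne rfl
      intro S hS
      rw [← h0] at hS hy ⊢
      exact cycle_exch h3 c hinj hB hadj (hKH i) (h0 ▸ hHK i) (hBA i) (x j) hij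
        (hBA j (hxB j)) ((hH _ _).2 (Or.inl hy)) hU A hA S hS
    · obtain ⟨z, hz, hs, hzx⟩ := hsimp i (by omega)
      refine exch_of_simpl (hA hz) (hKH i _ _ hzx) ?_
      intro u hu hzu hux
      exact hKH i _ _ (hs _ _ hzx (hHK i z u hz hzx.ne hzu) hux.symm)
  · intro A hA hxA
    refine vd_of_simpl _ A rfl fun A' hA' hne => ?_
    obtain ⟨u, hu⟩ := hne
    obtain ⟨i, -, hui⟩ := Finset.mem_biUnion.1 (hA (hA' hu))
    have key : ∃ z, SimplIn (Gs i) (A' ∩ B i) z := by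
      by_cases hi : (i : ℕ) < t
      · obtain ⟨h3, hc⟩ := hcyc i hi
        obtain ⟨c, hinj, h0, hB, hadj⟩ := cycle_param h3 hc (hxB i)
        refine cycle_simpl h3 c hadj _ (fun w hw => (hB w).1 (Finset.mem_inter.1 hw).2) ?_
          ⟨u, Finset.mem_inter.2 ⟨hu, hui⟩⟩
        rw [h0]
        exact fun h => hxA i (hA' (Finset.mem_inter.1 h).1)
      · exact dirac (hchordal i (by omega)) _ ⟨u, Finset.mem_inter.2 ⟨hu, hui⟩⟩
    obtain ⟨z, hz, hs⟩ := key
    obtain ⟨hzA, hzB⟩ := Finset.mem_inter.1 hz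
    have hzx : z ≠ x i := by
      rintro rfl
      exact hxA i (hA' hzA)
    refine ⟨z, hzA, ?_⟩
    intro v hv w hw hzv hzw hvw
    have hv' := hHK i z v hzB hzx hzv
    have hw' := hHK i z w hzB hzx hzw
    exact hKH i _ _ (hs v (Finset.mem_inter.2 ⟨hv, (hsupp i _ _ hv').2⟩) w
      (Finset.mem_inter.2 ⟨hw, (hsupp i _ _ hw').2⟩) hv' hw' hvw)
end
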